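/- Let 0 < ν < 1/2, and let f be locally integrable on (0,∞) with f(x) = O(x^{−a}) as x → 0⁺ and f(x) = O(x^{−b}) as x → ∞, where a < ν and 5/4 < b < 3/2, with Mellin transform satisfying f*(1) = 0 and (f*)′(1) = 0, and assume τ ↦ (F f)(τ)·τ·e^{πτ} is absolutely integrable on (0,∞). Then for every t > 0, (1/(2π))·∫_ℝ Γ(s)·Γ(1/2+s)·f*(1−s)·t^{−s} du = (16/π^{3/2})·∫_0^∞ τ·sinh(2πτ)·K_{2iτ}(2/√t)·(F f)(τ) dτ, where s = (1−ν) + iu on the left-hand side. -/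

import Mathlib

open MeasureTheory Set Filter Asymptotics

/-- Modified Bessel function of the second kind (integral representation, for Re z > 0). -/
noncomputable def besselK (nu z : ℂ) : ℂ :=
  ∫ t in Set.Ioi (0:ℝ), Complex.exp (-z * (Real.cosh t : ℂ)) * Complex.cosh (nu * (t : ℂ))

/-- The kernel 𝒦(x,τ) = ker²_{2iτ}(2(4x)^{1/4}) + kei²_{2iτ}(2(4x)^{1/4})
    = K_{2iτ}(2(4x)^{1/4}e^{iπ/4}) · K_{2iτ}(2(4x)^{1/4}e^{-iπ/4}), which is real. -/
noncomputable def kernelK (x τ : ℝ) : ℝ :=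
  (besselK (2 * Complex.I * (τ:ℂ))
      (((2 * (4*x) ^ ((1:ℝ)/4) : ℝ) : ℂ) * Complex.exp (Complex.I * (Real.pi:ℂ) / 4)) *
   besselK (2 * Complex.I * (τ:ℂ))
      (((2 * (4*x) ^ ((1:ℝ)/4) : ℝ) : ℂ) * Complex.exp (-(Complex.I * (Real.pi:ℂ)) / 4))).re

/-- K₀(y) = ∫₀^∞ exp(−y·cosh t) dt. -/
noncomputable def besselK0 (y : ℝ) : ℝ := ∫ t in Set.Ioi (0:ℝ), Real.exp (-y * Real.cosh t)

/-- K_{iτ}(x) = ∫₀^∞ exp(−x·cosh t)·cos(τt) dt (real-valued, purely imaginary order). -/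
noncomputable def besselKi (τ x : ℝ) : ℝ :=
  ∫ t in Set.Ioi (0:ℝ), Real.exp (-x * Real.cosh t) * Real.cos (τ * t)

/-- Modified Bessel function of the first kind I_ν(z) (power series). -/
noncomputable def besselI (nu z : ℂ) : ℂ :=
  ∑' n : ℕ, (z/2) ^ (nu + 2*(n:ℂ)) / ((n.factorial : ℂ) * Complex.Gamma (nu + (n:ℂ) + 1))

/-- B_ν(w) = ber²_ν(w) + bei²_ν(w) = I_ν(w·e^{iπ/4})·I_ν(w·e^{−iπ/4}). -/
noncomputable def kelvinB (nu w : ℂ) : ℂ :=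
  besselI nu (w * Complex.exp (Complex.I * (Real.pi:ℂ) / 4)) *
  besselI nu (w * Complex.exp (-(Complex.I * (Real.pi:ℂ)) / 4))

/-- Index transform (1.1): (F f)(τ) = ∫₀^∞ 𝒦(x,τ) f(x) dx. -/
noncomputable def indexF (f : ℝ → ℝ) (τ : ℝ) : ℝ := ∫ x in Set.Ioi (0:ℝ), kernelK x τ * f x

/-- Index transform (1.2): (G g)(x) = ∫₀^∞ 𝒦(x,τ) g(τ) dτ. -/
noncomputable def indexG (g : ℝ → ℝ) (x : ℝ) : ℝ := ∫ τ in Set.Ioi (0:ℝ), kernelK x τ * g τ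

/-- Index transform (1.2) for complex-valued densities. -/
noncomputable def indexGC (g : ℝ → ℂ) (x : ℝ) : ℂ :=
  ∫ τ in Set.Ioi (0:ℝ), (kernelK x τ : ℂ) * g τ

/-- Mellin transform of a real function. -/
noncomputable def mellinT (f : ℝ → ℝ) (s : ℂ) : ℂ :=
  ∫ x in Set.Ioi (0:ℝ), (f x : ℂ) * (x:ℂ) ^ (s - 1)

/-- Mellin transform of a complex function. -/
noncomputable def mellinC (F : ℝ → ℂ) (s : ℂ) : ℂ :=
  ∫ x in Set.Ioi (0:ℝ), F x * (x:ℂ) ^ (s - 1)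

/-- The L_{ν,p}(ℝ₊) norm. -/
noncomputable def Lnorm (ν p : ℝ) (f : ℝ → ℝ) : ℝ :=
  (∫ x in Set.Ioi (0:ℝ), |f x| ^ p * x ^ (ν*p - 1)) ^ (1/p)

/-- Euler beta function B(a,b) = Γ(a)Γ(b)/Γ(a+b). -/
noncomputable def betaFn (a b : ℝ) : ℝ := Real.Gamma a * Real.Gamma b / Real.Gamma (a+b)

lemma one_add_sq_div_two_le_cosh (x : ℝ) : 1 + x ^ 2 / 2 ≤ Real.cosh x := by
  have h1 : Real.cosh x = 1 + 2 * Real.sinh (x / 2) ^ 2 := by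
    have h := Real.cosh_two_mul (x / 2)
    rw [show 2 * (x / 2) = x by ring, Real.cosh_sq] at h
    linarith
  have h2 : |x / 2| ≤ Real.sinh |x / 2| := Real.self_le_sinh_iff.2 (abs_nonneg _)
  have h3 : (x / 2) ^ 2 ≤ Real.sinh (x / 2) ^ 2 := by
    rw [← Real.abs_sinh] at h2
    exact sq_le_sq.2 h2
  nlinarith

lemma integrable_inv_cosh : Integrable (fun x : ℝ => (Real.cosh x)⁻¹) := by
  refine (integrable_inv_one_add_sq.const_mul 2).mono' ?_ (Eventually.of_forall fun x => ?_)
  · exact (Real.continuous_cosh.inv₀ fun x => (Real.cosh_pos x).ne').aestronglyMeasurable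
  · rw [Real.norm_of_nonneg (inv_nonneg.2 (Real.cosh_pos x).le), ← div_eq_mul_inv,
      inv_eq_one_div, div_le_div_iff₀ (Real.cosh_pos x) (by positivity)]
    have := one_add_sq_div_two_le_cosh x
    nlinarith

lemma exp_neg_le_inv {z : ℝ} (hz : 0 < z) : Real.exp (-z) ≤ z⁻¹ := by
  rw [Real.exp_neg]
  exact inv_anti₀ hz (by linarith [Real.add_one_le_exp z])

lemma mul_exp_neg_le_inv {z : ℝ} (hz : 0 < z) : z * Real.exp (-z) ≤ 2 * z⁻¹ := by
  have h := Real.quadratic_le_exp_of_nonneg hz.le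
  rw [Real.exp_neg, ← div_eq_mul_inv, ← div_eq_mul_inv, div_le_div_iff₀ (Real.exp_pos z) hz]
  nlinarith

lemma integrable_exp_neg_mul_cosh {k : ℝ} (hk : 0 < k) :
    Integrable (fun x : ℝ => Real.exp (-k * Real.cosh x)) := by
  refine (integrable_inv_cosh.const_mul k⁻¹).mono' (by fun_prop) (Eventually.of_forall fun x => ?_)
  rw [Real.norm_of_nonneg (Real.exp_pos _).le, ← mul_inv, neg_mul]
  exact exp_neg_le_inv (mul_pos hk (Real.cosh_pos x))

lemma integrable_cosh_mul_exp_neg_mul_cosh {k : ℝ} (hk : 0 < k) :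
    Integrable (fun x : ℝ => Real.cosh x * Real.exp (-k * Real.cosh x)) := by
  refine (integrable_inv_cosh.const_mul (2 * (k⁻¹ * k⁻¹))).mono' (by fun_prop)
    (Eventually.of_forall fun x => ?_)
  have hc := Real.cosh_pos x
  rw [Real.norm_of_nonneg (by positivity)]
  have h := mul_exp_neg_le_inv (mul_pos hk hc)
  rw [mul_inv, ← neg_mul] at h
  calc Real.cosh x * Real.exp (-k * Real.cosh x)
      = k⁻¹ * (k * Real.cosh x * Real.exp (-k * Real.cosh x)) := by field_simp
    _ ≤ k⁻¹ * (2 * (k⁻¹ * (Real.cosh x)⁻¹)) := by gcongr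
    _ = _ := by ring

/-- Integral of an even function over the line. -/
lemma integral_eq_two_mul_Ioi_of_even {g : ℝ → ℝ} (heven : ∀ x, g (-x) = g x) :
    ∫ x, g x = 2 * ∫ x in Ioi (0 : ℝ), g x := by
  rw [← integral_comp_abs]
  congr 1
  ext x
  rcases abs_choice x with h | h <;> rw [h]
  exact (heven x).symm

/-- The Fourier integral of an even real function is its cosine transform. -/
lemma integral_even_mul_cexp {g : ℝ → ℝ} (hg : Integrable g) (heven : ∀ x, g (-x) = g x) (σ : ℝ) :
    ∫ x : ℝ, (g x : ℂ) * Complex.exp (Complex.I * σ * x)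
      = ((2 * ∫ x in Ioi (0 : ℝ), g x * Real.cos (σ * x) : ℝ) : ℂ) := by
  have hc : Integrable (fun x : ℝ => g x * Real.cos (σ * x)) :=
    hg.mul_bdd (c := 1) (by fun_prop) (Eventually.of_forall fun x => by
      simpa using Real.abs_cos_le_one _)
  have hs : Integrable (fun x : ℝ => g x * Real.sin (σ * x)) :=
    hg.mul_bdd (c := 1) (by fun_prop) (Eventually.of_forall fun x => by
      simpa using Real.abs_sin_le_one _)
  have h0 : ∫ x : ℝ, g x * Real.sin (σ * x) = 0 := by
    have h := integral_neg_eq_self (fun x : ℝ => g x * Real.sin (σ * x)) volume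
    simp only [heven, mul_neg, Real.sin_neg, integral_neg] at h
    linarith
  have he : ∀ x : ℝ, (g x : ℂ) * Complex.exp (Complex.I * σ * x)
      = ((g x * Real.cos (σ * x) : ℝ) : ℂ) + ((g x * Real.sin (σ * x) : ℝ) : ℂ) * Complex.I := by
    intro x
    rw [show Complex.I * σ * x = ((σ * x : ℝ) : ℂ) * Complex.I by push_cast; ring,
      Complex.exp_mul_I]
    push_cast
    ring
  simp_rw [he]
  rw [integral_add hc.ofReal (hs.ofReal.mul_const _), integral_mul_const, integral_complex_ofReal,
    integral_complex_ofReal, h0, integral_eq_two_mul_Ioi_of_even]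
  · simp
  · intro x
    simp [heven]

lemma besselKi_eq_integral_cexp {y : ℝ} (hy : 0 < y) (σ : ℝ) :
    ((2 * besselKi σ y : ℝ) : ℂ)
      = ∫ p : ℝ, (Real.exp (-y * Real.cosh p) : ℂ) * Complex.exp (Complex.I * σ * p) := by
  rw [integral_even_mul_cexp (integrable_exp_neg_mul_cosh hy) (by simp), besselKi]

lemma norm_cexp_I_mul (a b : ℝ) : ‖Complex.exp (Complex.I * a * b)‖ = 1 := by
  rw [show Complex.I * a * b = ((a * b : ℝ) : ℂ) * Complex.I by push_cast; ring,
    Complex.norm_exp_ofReal_mul_I]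

/-- Integration by parts: the order of the Bessel function against a first-order moment. -/
lemma mul_besselKi_eq {y : ℝ} (hy : 0 < y) (σ : ℝ) :
    Complex.I * σ * (2 * besselKi σ y : ℝ)
      = y * ∫ p : ℝ, (Real.sinh p * Real.exp (-y * Real.cosh p) : ℂ)
        * Complex.exp (Complex.I * σ * p) := by
  have hb : ∀ p : ℝ, |Real.sinh p| ≤ Real.cosh p := fun p => by
    rw [Real.abs_sinh, ← Real.cosh_abs p]; exact (Real.sinh_lt_cosh _).le
  have hi1 : Integrable (fun p : ℝ => (Real.exp (-y * Real.cosh p) : ℂ)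
      * Complex.exp (Complex.I * σ * p)) :=
    (integrable_exp_neg_mul_cosh hy).ofReal.mul_bdd (c := 1) (by fun_prop)
      (Eventually.of_forall fun p => (norm_cexp_I_mul σ p).le)
  have hi2 : Integrable (fun p : ℝ => (Real.sinh p * Real.exp (-y * Real.cosh p) : ℂ)
      * Complex.exp (Complex.I * σ * p)) := by
    refine (integrable_cosh_mul_exp_neg_mul_cosh hy).mono' (by fun_prop)
      (Eventually.of_forall fun p => ?_)
    rw [norm_mul, norm_mul, norm_cexp_I_mul, mul_one, Complex.norm_real, Complex.norm_real,
      Real.norm_eq_abs, Real.norm_of_nonneg (Real.exp_pos _).le]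
    gcongr
    exact hb p
  have hd : ∀ p : ℝ, HasDerivAt (fun p : ℝ => (Real.exp (-y * Real.cosh p) : ℂ)
      * Complex.exp (Complex.I * σ * p))
      (Complex.I * σ * ((Real.exp (-y * Real.cosh p) : ℂ) * Complex.exp (Complex.I * σ * p))
        - y * ((Real.sinh p * Real.exp (-y * Real.cosh p) : ℂ)
        * Complex.exp (Complex.I * σ * p))) p := by
    intro p
    have h1 : HasDerivAt (fun p : ℝ => ((Real.exp (-y * Real.cosh p) : ℝ) : ℂ))
        ((Real.exp (-y * Real.cosh p) * (-y * Real.sinh p) : ℝ) : ℂ) p :=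
      (((Real.hasDerivAt_cosh p).const_mul (-y)).exp).ofReal_comp
    have h2 : HasDerivAt (fun p : ℝ => Complex.exp (Complex.I * σ * p))
        (Complex.exp (Complex.I * σ * p) * (Complex.I * σ * 1)) p :=
      (((hasDerivAt_id (p : ℂ)).const_mul (Complex.I * σ)).cexp).comp_ofReal
    exact (h1.mul h2).congr_deriv (by push_cast; ring)
  have h := integral_eq_zero_of_hasDerivAt_of_integrable hd
    ((hi1.const_mul _).sub (hi2.const_mul _)) hi1
  rw [integral_sub (hi1.const_mul _) (hi2.const_mul _), integral_const_mul, integral_const_mul,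
    ← besselKi_eq_integral_cexp hy] at h
  exact sub_eq_zero.1 h

lemma integral_Ioi_eq_integral_exp {E : Type*} [NormedAddCommGroup E] [NormedSpace ℝ E]
    (g : ℝ → E) : ∫ s in Ioi (0 : ℝ), g s = ∫ p : ℝ, Real.exp p • g (Real.exp p) := by
  have h := integral_image_eq_integral_abs_deriv_smul (s := univ) (f := Real.exp)
    (f' := Real.exp) MeasurableSet.univ (fun x _ => (Real.hasDerivAt_exp x).hasDerivWithinAt)
    Real.exp_injective.injOn g
  rw [image_univ, Real.range_exp] at h
  simpa using h

/-- Gaussian subordination for the exponential of a reciprocal. -/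
lemma cexp_neg_div_eq_integral {y s : ℝ} (hy : 0 < y) (hs : 0 < s) :
    (Real.exp (-(y / 2) / s) : ℂ) = (Real.sqrt (y / (2 * Real.pi)) * s ^ (1 / 2 : ℝ) : ℝ)
      * ∫ t : ℝ, Complex.exp (Complex.I * y * t) * (Real.exp (-(y / 2 * s) * t ^ 2) : ℂ) := by
  have hk : 0 < y / 2 * s := by positivity
  have h := fourierIntegral_gaussian (b := ((y / 2 * s : ℝ) : ℂ)) (by simpa using hk) (y : ℂ)
  have h1 : ((Real.pi : ℂ) / ((y / 2 * s : ℝ) : ℂ)) ^ (1 / 2 : ℂ)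
      = ((Real.sqrt (Real.pi / (y / 2 * s)) : ℝ) : ℂ) := by
    rw [Real.sqrt_eq_rpow, Complex.ofReal_cpow (by positivity)]
    push_cast
    rfl
  have h2 : Complex.exp (-(y : ℂ) ^ 2 / (4 * ((y / 2 * s : ℝ) : ℂ)))
      = (Real.exp (-(y / 2) / s) : ℂ) := by
    rw [Complex.ofReal_exp]
    congr 1
    push_cast
    field_simp
    norm_num
  rw [h1, h2] at h
  have h3 : ∀ t : ℝ, (Real.exp (-(y / 2 * s) * t ^ 2) : ℂ)
      = Complex.exp (-((y / 2 * s : ℝ) : ℂ) * (t : ℂ) ^ 2) := fun t => by push_cast; rfl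
  simp_rw [h3]
  rw [h, ← mul_assoc, ← Complex.ofReal_mul, ← Real.sqrt_eq_rpow, ← Real.sqrt_mul (by positivity),
    ← Real.sqrt_mul (by positivity)]
  have h4 : y / (2 * Real.pi) * s * (Real.pi / (y / 2 * s)) = 1 := by
    field_simp
  rw [h4]
  simp

lemma integrable_basset {y : ℝ} (hy : 0 < y) (σ : ℝ) :
    Integrable (Function.uncurry fun s t : ℝ =>
      ((s : ℂ) ^ ((3 / 2 + Complex.I * σ : ℂ) - 1) * (Real.exp (-(y / 2) * s) : ℂ)) *
      (Complex.exp (Complex.I * y * t) * (Real.exp (-(y / 2 * s) * t ^ 2) : ℂ)))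
      ((volume.restrict (Ioi 0)).prod volume) := by
  have hm : AEStronglyMeasurable (Function.uncurry fun s t : ℝ =>
      ((s : ℂ) ^ ((3 / 2 + Complex.I * σ : ℂ) - 1) * (Real.exp (-(y / 2) * s) : ℂ)) *
      (Complex.exp (Complex.I * y * t) * (Real.exp (-(y / 2 * s) * t ^ 2) : ℂ)))
      ((volume.restrict (Ioi 0)).prod volume) := by
    apply Measurable.aestronglyMeasurable
    unfold Function.uncurry
    fun_prop
  have hn : ∀ s ∈ Ioi (0 : ℝ), ∀ t : ℝ,
      ‖((s : ℂ) ^ ((3 / 2 + Complex.I * σ : ℂ) - 1) * (Real.exp (-(y / 2) * s) : ℂ)) *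
      (Complex.exp (Complex.I * y * t) * (Real.exp (-(y / 2 * s) * t ^ 2) : ℂ))‖
      = (s ^ (1 / 2 : ℝ) * Real.exp (-(y / 2) * s)) * Real.exp (-(y / 2 * s) * t ^ 2) := by
    intro s hs t
    rw [norm_mul, norm_mul, norm_mul, norm_cexp_I_mul, one_mul, Complex.norm_real,
      Complex.norm_real, Real.norm_of_nonneg (Real.exp_pos _).le,
      Real.norm_of_nonneg (Real.exp_pos _).le, Complex.norm_cpow_eq_rpow_re_of_pos hs]
    norm_num
  rw [integrable_prod_iff hm]
  constructor
  · refine (ae_restrict_iff' measurableSet_Ioi).2 (Eventually.of_forall fun s hs => ?_)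
    have hs' : 0 < y / 2 * s := mul_pos (by positivity) hs
    refine ((integrable_exp_neg_mul_sq hs').const_mul _).mono'
      (Measurable.aestronglyMeasurable (by unfold Function.uncurry; fun_prop))
      (Eventually.of_forall fun t => (hn s hs t).le)
  · have hi : IntegrableOn (fun s : ℝ => Real.sqrt (Real.pi / (y / 2)) * Real.exp (-(y / 2) * s))
        (Ioi 0) := (exp_neg_integrableOn_Ioi 0 (by positivity)).const_mul _
    refine hi.congr_fun (fun s hs => ?_) measurableSet_Ioi
    have hs' : 0 < s := hs
    simp only [Function.uncurry]
    simp_rw [hn s hs]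
    rw [integral_const_mul, integral_gaussian, ← Real.sqrt_eq_rpow]
    have : Real.sqrt (Real.pi / (y / 2 * s)) * Real.sqrt s = Real.sqrt (Real.pi / (y / 2)) := by
      rw [← Real.sqrt_mul (by positivity)]
      congr 1
      field_simp
    rw [← this]
    ring

/-- Basset-type bound for the first-order moment of the Bessel integrand. -/
lemma norm_integral_exp_mul_cexp_le {y : ℝ} (hy : 0 < y) (σ : ℝ) :
    ‖∫ p : ℝ, (Real.exp p * Real.exp (-y * Real.cosh p) : ℂ) * Complex.exp (Complex.I * σ * p)‖
      ≤ 2 * Real.sqrt Real.pi * ‖Complex.Gamma (3 / 2 + Complex.I * σ)‖ / y := by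
  set a : ℂ := 3 / 2 + Complex.I * σ with ha
  have hare : a.re = 3 / 2 := by simp [ha]
  have h1 : ∫ p : ℝ, (Real.exp p * Real.exp (-y * Real.cosh p) : ℂ)
      * Complex.exp (Complex.I * σ * p)
      = ∫ s in Ioi (0 : ℝ), (s : ℂ) ^ (Complex.I * σ) * (Real.exp (-(y / 2) * s) : ℂ)
        * (Real.exp (-(y / 2) / s) : ℂ) := by
    rw [integral_Ioi_eq_integral_exp]
    congr 1
    ext p
    rw [Complex.real_smul, Complex.cpow_def_of_ne_zero (by exact_mod_cast (Real.exp_pos p).ne'),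
      ← Complex.ofReal_log (Real.exp_pos p).le, Real.log_exp]
    have : -y * Real.cosh p = -(y / 2) * Real.exp p + -(y / 2) / Real.exp p := by
      rw [Real.cosh_eq, Real.exp_neg]
      ring
    rw [this, Real.exp_add, mul_comm (p : ℂ)]
    push_cast
    ring
  have h2 : ∫ s in Ioi (0 : ℝ), (s : ℂ) ^ (Complex.I * σ) * (Real.exp (-(y / 2) * s) : ℂ)
        * (Real.exp (-(y / 2) / s) : ℂ)
      = (Real.sqrt (y / (2 * Real.pi)) : ℂ) * ∫ s in Ioi (0 : ℝ), ∫ t : ℝ,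
        ((s : ℂ) ^ (a - 1) * (Real.exp (-(y / 2) * s) : ℂ)) *
        (Complex.exp (Complex.I * y * t) * (Real.exp (-(y / 2 * s) * t ^ 2) : ℂ)) := by
    rw [← integral_const_mul]
    refine setIntegral_congr_fun measurableSet_Ioi fun s hs => ?_
    have hs' : (0 : ℝ) < s := hs
    rw [cexp_neg_div_eq_integral hy hs, integral_const_mul]
    have : (s : ℂ) ^ (a - 1) = (s : ℂ) ^ (Complex.I * σ) * ((s ^ (1 / 2 : ℝ) : ℝ) : ℂ) := by
      rw [Complex.ofReal_cpow hs'.le, ← Complex.cpow_add _ _ (by exact_mod_cast hs'.ne')]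
      congr 1
      rw [ha]
      push_cast
      ring
    rw [this]
    push_cast
    ring
  have h3 : ∀ t : ℝ, ∫ s in Ioi (0 : ℝ),
        ((s : ℂ) ^ (a - 1) * (Real.exp (-(y / 2) * s) : ℂ)) *
        (Complex.exp (Complex.I * y * t) * (Real.exp (-(y / 2 * s) * t ^ 2) : ℂ))
      = Complex.exp (Complex.I * y * t) *
        ((1 / ((y / 2 * (1 + t ^ 2) : ℝ) : ℂ)) ^ a * Complex.Gamma a) := by
    intro t
    rw [← Complex.integral_cpow_mul_exp_neg_mul_Ioi (by rw [hare]; norm_num) (by positivity),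
      ← integral_const_mul]
    congr 1
    ext s
    have : Complex.exp (-(((y / 2 * (1 + t ^ 2) : ℝ) : ℂ) * s))
        = (Real.exp (-(y / 2) * s) : ℂ) * (Real.exp (-(y / 2 * s) * t ^ 2) : ℂ) := by
      rw [Complex.ofReal_exp, Complex.ofReal_exp, ← Complex.exp_add]
      congr 1
      push_cast
      ring
    rw [this]
    ring
  have hswap := integral_integral_swap (integrable_basset hy σ)
  simp only [← ha, h3] at hswap
  rw [h1, h2, hswap]
  rw [norm_mul, Complex.norm_real, Real.norm_of_nonneg (Real.sqrt_nonneg _)]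
  have h4 : ‖∫ t : ℝ, Complex.exp (Complex.I * y * t) *
        ((1 / ((y / 2 * (1 + t ^ 2) : ℝ) : ℂ)) ^ a * Complex.Gamma a)‖
      ≤ (2 / y) ^ (3 / 2 : ℝ) * ‖Complex.Gamma a‖ * Real.pi := by
    rw [← integral_univ_inv_one_add_sq, ← integral_const_mul]
    refine norm_integral_le_of_norm_le (integrable_inv_one_add_sq.const_mul _)
      (Eventually.of_forall fun t => ?_)
    rw [norm_mul, norm_cexp_I_mul, one_mul, norm_mul]
    have hr : ‖(1 / ((y / 2 * (1 + t ^ 2) : ℝ) : ℂ)) ^ a‖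
        = (2 / y * (1 + t ^ 2)⁻¹) ^ (3 / 2 : ℝ) := by
      rw [show (1 / ((y / 2 * (1 + t ^ 2) : ℝ) : ℂ)) = ((2 / y * (1 + t ^ 2)⁻¹ : ℝ) : ℂ) by
        push_cast
        rw [one_div, mul_inv, inv_div], Complex.norm_cpow_eq_rpow_re_of_pos (by positivity), hare]
    rw [hr, Real.mul_rpow (by positivity) (by positivity), mul_assoc, mul_assoc,
      mul_comm ‖Complex.Gamma a‖]
    gcongr
    have h1t : (1 + t ^ 2)⁻¹ ≤ 1 := inv_le_one_of_one_le₀ (by nlinarith [sq_nonneg t])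
    simpa using Real.rpow_le_rpow_of_exponent_ge (by positivity) h1t
      (show (1 : ℝ) ≤ 3 / 2 by norm_num)
  calc _ ≤ Real.sqrt (y / (2 * Real.pi)) *
        ((2 / y) ^ (3 / 2 : ℝ) * ‖Complex.Gamma a‖ * Real.pi) := by
        gcongr
    _ = _ := by
      have h5 : (2 / y) ^ (3 / 2 : ℝ) = 2 / y * Real.sqrt (2 / y) := by
        rw [show (3 / 2 : ℝ) = 1 + 1 / 2 by norm_num, Real.rpow_add (by positivity),
          Real.rpow_one, Real.sqrt_eq_rpow]
      have h6 : Real.sqrt (y / (2 * Real.pi)) * Real.sqrt (2 / y) * Real.pi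
          = Real.sqrt Real.pi := by
        rw [← Real.sqrt_mul (by positivity)]
        rw [show y / (2 * Real.pi) * (2 / y) = Real.pi⁻¹ by field_simp, Real.sqrt_inv]
        rw [inv_mul_eq_div, Real.div_sqrt]
      rw [h5]
      calc _ = 2 / y * ‖Complex.Gamma a‖ *
            (Real.sqrt (y / (2 * Real.pi)) * Real.sqrt (2 / y) * Real.pi) := by ring
        _ = _ := by rw [h6]; ring

lemma norm_sq_Gamma_three_halves (σ : ℝ) :
    ‖Complex.Gamma (3 / 2 + Complex.I * σ)‖ ^ 2
      = (1 / 4 + σ ^ 2) * Real.pi / Real.cosh (Real.pi * σ) := by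
  have h1 : Complex.Gamma (3 / 2 + Complex.I * σ)
      = (1 / 2 + Complex.I * σ) * Complex.Gamma (1 / 2 + Complex.I * σ) := by
    rw [← Complex.Gamma_add_one]
    · congr 1
      ring
    · intro h
      have := congrArg Complex.re h
      simp at this
  have h2 := Complex.Gamma_mul_Gamma_one_sub (1 / 2 + Complex.I * σ)
  have h3 : (1 - (1 / 2 + Complex.I * σ) : ℂ) = (starRingEnd ℂ) (1 / 2 + Complex.I * σ) := by
    simp only [map_add, map_mul, map_div₀, map_one, map_ofNat, Complex.conj_I, Complex.conj_ofReal]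
    ring
  rw [h3, Complex.Gamma_conj, Complex.mul_conj,
    show (Real.pi : ℂ) * (1 / 2 + Complex.I * σ) = ((Real.pi * σ : ℝ) : ℂ) * Complex.I
      + Real.pi / 2 by push_cast; ring, Complex.sin_add_pi_div_two, Complex.cos_mul_I,
    ← Complex.ofReal_cosh, ← Complex.ofReal_div, Complex.ofReal_inj,
    Complex.normSq_eq_norm_sq] at h2
  have h4 : ‖(1 / 2 + Complex.I * σ : ℂ)‖ ^ 2 = 1 / 4 + σ ^ 2 := by
    rw [← Complex.normSq_eq_norm_sq, Complex.normSq_apply]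
    simp
    ring
  rw [h1, norm_mul, mul_pow, h2, h4]
  ring

lemma norm_Gamma_three_halves_neg (σ : ℝ) :
    ‖Complex.Gamma (3 / 2 + Complex.I * (-σ : ℝ))‖ = ‖Complex.Gamma (3 / 2 + Complex.I * σ)‖ := by
  rw [← sq_eq_sq₀ (norm_nonneg _) (norm_nonneg _), norm_sq_Gamma_three_halves,
    norm_sq_Gamma_three_halves]
  simp

/-- Uniform bound for the Bessel function of imaginary order. -/
lemma abs_mul_besselKi_le {y : ℝ} (hy : 0 < y) (σ : ℝ) :
    |σ * besselKi σ y| ≤ Real.sqrt Real.pi * ‖Complex.Gamma (3 / 2 + Complex.I * σ)‖ := by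
  have h := mul_besselKi_eq hy σ
  have hi : ∀ σ : ℝ, Integrable fun p : ℝ => (Real.exp p * Real.exp (-y * Real.cosh p) : ℂ)
      * Complex.exp (Complex.I * σ * p) := by
    intro σ
    refine ((integrable_cosh_mul_exp_neg_mul_cosh hy).const_mul 2).mono' (by fun_prop)
      (Eventually.of_forall fun p => ?_)
    rw [norm_mul, norm_mul, norm_cexp_I_mul, mul_one, Complex.norm_real, Complex.norm_real,
      Real.norm_of_nonneg (Real.exp_pos _).le, Real.norm_of_nonneg (Real.exp_pos _).le, ← mul_assoc]
    gcongr
    rw [Real.cosh_eq]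
    linarith [Real.exp_pos (-p)]
  set A : ℝ → ℂ := fun σ => ∫ p : ℝ, (Real.exp p * Real.exp (-y * Real.cosh p) : ℂ)
      * Complex.exp (Complex.I * σ * p) with hA
  have hneg : ∫ p : ℝ, (Real.exp (-p) * Real.exp (-y * Real.cosh p) : ℂ)
      * Complex.exp (Complex.I * σ * p) = A (-σ) := by
    rw [hA, ← integral_neg_eq_self]
    simp
  have hi' : Integrable fun p : ℝ => (Real.exp (-p) * Real.exp (-y * Real.cosh p) : ℂ)
      * Complex.exp (Complex.I * σ * p) := by
    have := (hi (-σ)).comp_neg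
    simpa using this
  have hs : ∫ p : ℝ, (Real.sinh p * Real.exp (-y * Real.cosh p) : ℂ)
        * Complex.exp (Complex.I * σ * p) = 1 / 2 * (A σ - A (-σ)) := by
    rw [← hneg, hA, ← integral_sub (hi σ) hi', ← integral_const_mul]
    congr 1
    ext p
    rw [Real.sinh_eq]
    push_cast
    ring
  rw [hs] at h
  have hn := congrArg norm h
  rw [norm_mul, norm_mul, norm_mul, norm_mul, Complex.norm_I, one_mul, Complex.norm_real,
    Complex.norm_real, Complex.norm_real] at hn
  have hb1 := norm_integral_exp_mul_cexp_le hy σ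
  have hb2 := norm_integral_exp_mul_cexp_le hy (-σ)
  rw [norm_Gamma_three_halves_neg] at hb2
  have hb : ‖A σ - A (-σ)‖
      ≤ 2 * (2 * Real.sqrt Real.pi * ‖Complex.Gamma (3 / 2 + Complex.I * σ)‖ / y) :=
    (norm_sub_le _ _).trans (by linarith)
  have h2 : 2 * |σ * besselKi σ y| = ‖y‖ * (‖(1 / 2 : ℂ)‖ * ‖A σ - A (-σ)‖) := by
    rw [← hn, abs_mul, Real.norm_eq_abs, Real.norm_eq_abs, abs_mul]
    norm_num
    ring
  rw [Real.norm_of_nonneg hy.le] at h2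
  norm_num at h2
  have h3 : y * (1 / 2 * ‖A σ - A (-σ)‖)
      ≤ y * (1 / 2 * (2 * (2 * Real.sqrt Real.pi * ‖Complex.Gamma (3 / 2 + Complex.I * σ)‖
        / y))) := by
    gcongr
  have h4 : y * (1 / 2 * (2 * (2 * Real.sqrt Real.pi *
      ‖Complex.Gamma (3 / 2 + Complex.I * σ)‖ / y)))
      = 2 * (Real.sqrt Real.pi * ‖Complex.Gamma (3 / 2 + Complex.I * σ)‖) := by
    field_simp
  rw [abs_mul] at *
  linarith

lemma sinh_le_mul_cosh {x : ℝ} (hx : 0 ≤ x) : Real.sinh x ≤ x * Real.cosh x := by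
  have hmono : MonotoneOn (fun x : ℝ => x * Real.cosh x - Real.sinh x) (Ici 0) := by
    have hd : ∀ x : ℝ, HasDerivAt (fun x : ℝ => x * Real.cosh x - Real.sinh x)
        (x * Real.sinh x) x := fun x => by
      refine (((hasDerivAt_id x).mul (Real.hasDerivAt_cosh x)).sub
        (Real.hasDerivAt_sinh x)).congr_deriv ?_
      simp
    refine monotoneOn_of_deriv_nonneg (convex_Ici 0) (by fun_prop) (by fun_prop) fun x hx => ?_
    rw [interior_Ici] at hx
    rw [(hd x).deriv]
    exact mul_nonneg (le_of_lt hx) (Real.sinh_nonneg_iff.2 (le_of_lt hx))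
  have := hmono (mem_Ici.2 le_rfl) hx hx
  simpa using this

/-- The kernel of the inverse index transform is dominated by `τ * exp (π τ)`. -/
lemma abs_inverse_kernel_le {y τ : ℝ} (hy : 0 < y) (hτ : 0 < τ) :
    |τ * Real.sinh (2 * Real.pi * τ) * besselKi (2 * τ) y|
      ≤ 2 * Real.pi * (τ * Real.exp (Real.pi * τ)) := by
  have hπ := Real.pi_pos
  have h := abs_mul_besselKi_le hy (2 * τ)
  have hG := norm_sq_Gamma_three_halves (2 * τ)
  have hc : 0 < Real.cosh (2 * Real.pi * τ) := Real.cosh_pos _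
  have hx : 0 ≤ 2 * Real.pi * τ := by positivity
  have hs1 := sinh_le_mul_cosh hx
  have hs2 : Real.sinh (2 * Real.pi * τ) ≤ Real.cosh (2 * Real.pi * τ) := (Real.sinh_lt_cosh _).le
  have hce : Real.cosh (2 * Real.pi * τ) ≤ Real.exp (Real.pi * τ) ^ 2 := by
    rw [← Real.exp_nat_mul, Real.cosh_eq]
    have : Real.exp (-(2 * Real.pi * τ)) ≤ Real.exp (2 * Real.pi * τ) :=
      Real.exp_le_exp.2 (by linarith)
    have h2 : ((2 : ℕ) : ℝ) * (Real.pi * τ) = 2 * Real.pi * τ := by push_cast; ring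
    rw [h2]
    linarith
  set S := Real.sinh (2 * Real.pi * τ)
  set Ch := Real.cosh (2 * Real.pi * τ)
  have h1 : (2 * τ * besselKi (2 * τ) y) ^ 2 ≤ Real.pi ^ 2 * ((1 / 4 + (2 * τ) ^ 2) / Ch) := by
    rw [← sq_abs]
    calc _ ≤ (Real.sqrt Real.pi * ‖Complex.Gamma (3 / 2 + Complex.I * (2 * τ : ℝ))‖) ^ 2 := by
          gcongr
      _ = _ := by
          rw [mul_pow, hG, Real.sq_sqrt hπ.le]
          rw [show Real.pi * (2 * τ) = 2 * Real.pi * τ by ring]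
          ring
  have h2 : S ^ 2 * (1 / 4 + (2 * τ) ^ 2) ≤ 16 * τ ^ 2 * Ch ^ 2 := by
    have a1 : S ^ 2 ≤ (2 * Real.pi * τ * Ch) ^ 2 := by gcongr
    have a2 : S ^ 2 ≤ Ch ^ 2 := by gcongr
    have a3 : S ^ 2 * τ ^ 2 ≤ Ch ^ 2 * τ ^ 2 := by gcongr
    have a4 : Real.pi ^ 2 ≤ 12 := by nlinarith [Real.pi_lt_d2]
    have a5 : Real.pi ^ 2 * (τ ^ 2 * Ch ^ 2) ≤ 12 * (τ ^ 2 * Ch ^ 2) := by gcongr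
    nlinarith
  refine abs_le_of_sq_le_sq ?_ (by positivity)
  have e1 : (τ * S * besselKi (2 * τ) y) ^ 2 = S ^ 2 * (2 * τ * besselKi (2 * τ) y) ^ 2 / 4 := by
    ring
  rw [e1]
  calc S ^ 2 * (2 * τ * besselKi (2 * τ) y) ^ 2 / 4
      ≤ S ^ 2 * (Real.pi ^ 2 * ((1 / 4 + (2 * τ) ^ 2) / Ch)) / 4 := by gcongr
    _ = Real.pi ^ 2 * (S ^ 2 * (1 / 4 + (2 * τ) ^ 2)) / Ch / 4 := by ring
    _ ≤ Real.pi ^ 2 * (16 * τ ^ 2 * Ch ^ 2) / Ch / 4 := by gcongr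
    _ = 4 * Real.pi ^ 2 * τ ^ 2 * Ch := by field_simp; norm_num
    _ ≤ 4 * Real.pi ^ 2 * τ ^ 2 * Real.exp (Real.pi * τ) ^ 2 := by gcongr
    _ = _ := by ring

lemma deriv_sigmoid_eq (x : ℝ) :
    Real.sigmoid x * (1 - Real.sigmoid x) = (2 * (1 + Real.cosh x))⁻¹ := by
  rw [Real.sigmoid_def, Real.cosh_eq, Real.exp_neg]
  field_simp
  ring

lemma integrable_deriv_sigmoid :
    Integrable fun x : ℝ => Real.sigmoid x * (1 - Real.sigmoid x) := by
  refine integrable_inv_cosh.mono' ?_ (Eventually.of_forall fun x => ?_)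
  · have := continuous_sigmoid
    exact (by fun_prop : Continuous fun x : ℝ =>
      Real.sigmoid x * (1 - Real.sigmoid x)).aestronglyMeasurable
  · have := Real.cosh_pos x
    rw [deriv_sigmoid_eq, Real.norm_of_nonneg (by positivity)]
    exact inv_anti₀ this (by linarith)

/-- Fourier transform of the logistic density. -/
lemma integral_deriv_sigmoid_mul_cexp {σ : ℝ} (hσ : σ ≠ 0) :
    ∫ x : ℝ, ((Real.sigmoid x * (1 - Real.sigmoid x) : ℝ) : ℂ) * Complex.exp (Complex.I * σ * x)
      = ((Real.pi * σ / Real.sinh (Real.pi * σ) : ℝ) : ℂ) := by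
  have hσI : Complex.I * σ ≠ 0 := mul_ne_zero Complex.I_ne_zero (by exact_mod_cast hσ)
  have h1 := Complex.Gamma_mul_Gamma_eq_betaIntegral (s := 1 + Complex.I * σ)
    (t := 1 - Complex.I * σ) (by simp) (by simp)
  have h2 : Complex.Gamma (1 + Complex.I * σ) * Complex.Gamma (1 - Complex.I * σ)
      = ((Real.pi * σ / Real.sinh (Real.pi * σ) : ℝ) : ℂ) := by
    rw [add_comm, Complex.Gamma_add_one _ hσI, mul_assoc, Complex.Gamma_mul_Gamma_one_sub,
      show (Real.pi : ℂ) * (Complex.I * σ) = ((Real.pi * σ : ℝ) : ℂ) * Complex.I by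
        push_cast; ring, Complex.sin_mul_I, ← Complex.ofReal_sinh]
    rw [Complex.ofReal_div, Complex.ofReal_mul]
    field_simp
  rw [show (1 + Complex.I * σ + (1 - Complex.I * σ) : ℂ) = ((1 : ℕ) : ℂ) + 1 by push_cast; ring,
    Complex.Gamma_nat_eq_factorial, h2] at h1
  rw [h1, Complex.betaIntegral, intervalIntegral.integral_of_le zero_le_one,
    integral_Ioc_eq_integral_Ioo, ← Real.range_sigmoid, ← image_univ,
    integral_image_eq_integral_abs_deriv_smul MeasurableSet.univ
      (fun x _ => (Real.hasDerivAt_sigmoid x).hasDerivWithinAt) Real.sigmoid_injective.injOn]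
  simp only [Nat.factorial_one, Nat.cast_one, one_mul, Measure.restrict_univ]
  congr 1
  ext x
  have p1 := Real.sigmoid_pos x
  have p2 : 0 < 1 - Real.sigmoid x := by linarith [Real.sigmoid_lt_one x]
  rw [abs_of_pos (mul_pos p1 p2), Complex.real_smul]
  congr 1
  have e1 : Real.log (1 - Real.sigmoid x) = Real.log (Real.sigmoid x) - x := by
    rw [← Real.sigmoid_neg, ← Real.sigmoid_mul_rexp_neg, Real.log_mul p1.ne' (Real.exp_pos _).ne',
      Real.log_exp]
    ring
  rw [Complex.cpow_def_of_ne_zero (by exact_mod_cast p1.ne'),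
    show (1 : ℂ) - (Real.sigmoid x : ℂ) = ((1 - Real.sigmoid x : ℝ) : ℂ) by push_cast; ring,
    Complex.cpow_def_of_ne_zero (by exact_mod_cast p2.ne'), ← Complex.ofReal_log p1.le,
    ← Complex.ofReal_log p2.le, ← Complex.exp_add, e1]
  congr 1
  push_cast
  ring

lemma sigmoid_sub_sigmoid (u v : ℝ) :
    Real.sigmoid (v + u) - Real.sigmoid (v - u)
      = Real.sinh u / (Real.cosh u + Real.cosh v) := by
  rw [Real.sigmoid_def, Real.sigmoid_def, Real.sinh_eq, Real.cosh_eq, Real.cosh_eq, neg_add,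
    neg_sub, Real.exp_add, Real.exp_sub, Real.exp_neg, Real.exp_neg]
  field_simp
  ring

lemma integral_cexp_div_cosh_add_cosh {σ u : ℝ} (hσ : σ ≠ 0) (hu : 0 < u) :
    ∫ v : ℝ, ((Real.sinh u / (Real.cosh u + Real.cosh v) : ℝ) : ℂ)
        * Complex.exp (Complex.I * σ * v)
      = ((2 * Real.pi * Real.sin (σ * u) / Real.sinh (Real.pi * σ) : ℝ) : ℂ) := by
  set l : ℝ → ℝ := fun x => Real.sigmoid x * (1 - Real.sigmoid x) with hl
  have hlc : Continuous l := by
    fun_prop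
  have h1 : ∀ v : ℝ, ((Real.sinh u / (Real.cosh u + Real.cosh v) : ℝ) : ℂ)
        * Complex.exp (Complex.I * σ * v)
      = ∫ w in Ioc (-u) u, (l (v + w) : ℂ) * Complex.exp (Complex.I * σ * v) := by
    intro v
    rw [integral_mul_const, ← intervalIntegral.integral_of_le (by linarith),
      intervalIntegral.integral_ofReal]
    congr 2
    rw [← sigmoid_sub_sigmoid, sub_eq_add_neg v u]
    refine (intervalIntegral.integral_eq_sub_of_hasDerivAt
      (f := fun w => Real.sigmoid (v + w)) (fun w _ => ?_) ?_).symm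
    · simpa using (Real.hasDerivAt_sigmoid (v + w)).comp_const_add v w
    · exact (hlc.comp (by fun_prop)).intervalIntegrable _ _
  have hInt : Integrable (Function.uncurry fun v w : ℝ =>
      (l (v + w) : ℂ) * Complex.exp (Complex.I * σ * v))
      (volume.prod (volume.restrict (Ioc (-u) u))) := by
    have hc : Continuous (Function.uncurry fun v w : ℝ =>
      (l (v + w) : ℂ) * Complex.exp (Complex.I * σ * v)) := by
      unfold Function.uncurry
      fun_prop
    have hn : ∀ v w : ℝ, ‖(l (v + w) : ℂ) * Complex.exp (Complex.I * σ * v)‖ = ‖l (v + w)‖ := by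
      intro v w
      rw [norm_mul, norm_cexp_I_mul, mul_one, Complex.norm_real]
    rw [integrable_prod_iff' hc.aestronglyMeasurable]
    constructor
    · refine Eventually.of_forall fun w => ?_
      exact (integrable_deriv_sigmoid.comp_add_right w).ofReal.mul_bdd (c := 1) (by fun_prop)
        (Eventually.of_forall fun v => (norm_cexp_I_mul σ v).le)
    · simp only [Function.uncurry, hn]
      have : ∀ w : ℝ, ∫ v, ‖l (v + w)‖ = ∫ v, ‖l v‖ := fun w =>
        integral_add_right_eq_self (fun v => ‖l v‖) w
      simp only [this]
      exact integrable_const _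
  have h2 : ∀ w : ℝ, ∫ v : ℝ, (l (v + w) : ℂ) * Complex.exp (Complex.I * σ * v)
      = Complex.exp (-(Complex.I * σ) * w) * ((Real.pi * σ / Real.sinh (Real.pi * σ) : ℝ) : ℂ) := by
    intro w
    rw [← integral_deriv_sigmoid_mul_cexp hσ, ← integral_const_mul,
      ← integral_add_right_eq_self (fun v : ℝ => Complex.exp (-(Complex.I * σ) * w)
        * ((l v : ℂ) * Complex.exp (Complex.I * σ * v))) w]
    congr 1
    ext v
    rw [mul_left_comm, ← Complex.exp_add]
    congr 2
    push_cast
    ring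
  have hσI : -(Complex.I * σ) ≠ 0 :=
    neg_ne_zero.2 (mul_ne_zero Complex.I_ne_zero (by exact_mod_cast hσ))
  simp_rw [h1]
  rw [integral_integral_swap hInt]
  simp_rw [h2]
  rw [integral_mul_const, ← intervalIntegral.integral_of_le (by linarith),
    integral_exp_mul_complex hσI]
  have hσ' : (σ : ℂ) ≠ 0 := by exact_mod_cast hσ
  have e : ((Real.sin (σ * u) : ℝ) : ℂ) = (Complex.exp (-(Complex.I * σ) * u)
      - Complex.exp (-(Complex.I * σ) * (-u : ℝ))) * Complex.I / 2 := by
    rw [Complex.ofReal_sin, Complex.sin]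
    push_cast
    ring_nf
  simp only [Complex.ofReal_div, Complex.ofReal_mul, e, Complex.ofReal_ofNat]
  field_simp
  rw [Complex.I_sq]
  ring

lemma integral_exp_neg_mul_Ioi {k : ℝ} (hk : 0 < k) :
    ∫ y in Ioi (0 : ℝ), Real.exp (-k * y) = k⁻¹ := by
  rw [integral_exp_mul_Ioi (by linarith), mul_zero, Real.exp_zero, neg_div_neg_eq, one_div]

/-- Laplace transform of the Bessel function of imaginary order. -/
lemma sinh_mul_laplace_besselKi {σ u : ℝ} (hσ : σ ≠ 0) (hu : 0 < u) :
    Real.sinh u * ∫ y in Ioi (0 : ℝ), Real.exp (-Real.cosh u * y) * besselKi σ y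
      = Real.pi * Real.sin (σ * u) / Real.sinh (Real.pi * σ) := by
  have h := integral_cexp_div_cosh_add_cosh hσ hu
  have hcu := Real.cosh_pos u
  have hpos : ∀ p : ℝ, 0 < Real.cosh u + Real.cosh p := fun p => add_pos hcu (Real.cosh_pos p)
  have hInt : Integrable (Function.uncurry fun y p : ℝ =>
      (Real.exp (-(Real.cosh u + Real.cosh p) * y) : ℂ) * Complex.exp (Complex.I * σ * p))
      ((volume.restrict (Ioi 0)).prod volume) := by
    have hc : Continuous (Function.uncurry fun y p : ℝ =>
      (Real.exp (-(Real.cosh u + Real.cosh p) * y) : ℂ) * Complex.exp (Complex.I * σ * p)) := by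
      unfold Function.uncurry
      fun_prop
    have hi : ∀ p : ℝ, ∫ y in Ioi (0 : ℝ), Real.exp (-(Real.cosh u + Real.cosh p) * y)
        = (Real.cosh u + Real.cosh p)⁻¹ := fun p =>
      integral_exp_neg_mul_Ioi (hpos p)
    rw [integrable_prod_iff' hc.aestronglyMeasurable]
    constructor
    · refine Eventually.of_forall fun p => ?_
      have : IntegrableOn (fun y : ℝ => (Real.exp (-(Real.cosh u + Real.cosh p) * y) : ℂ)
          * Complex.exp (Complex.I * σ * p)) (Ioi 0) :=
        ((exp_neg_integrableOn_Ioi 0 (hpos p)).ofReal).mul_const _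
      exact this
    · simp only [Function.uncurry, norm_mul, norm_cexp_I_mul, mul_one, Complex.norm_real,
        Real.norm_of_nonneg (Real.exp_pos _).le, hi]
      refine integrable_inv_cosh.mono' ?_ (Eventually.of_forall fun p => ?_)
      · exact ((by fun_prop : Continuous fun p : ℝ => Real.cosh u + Real.cosh p).inv₀
          fun p => (hpos p).ne').aestronglyMeasurable
      · rw [Real.norm_of_nonneg (inv_nonneg.2 (hpos p).le)]
        exact inv_anti₀ (Real.cosh_pos p) (by linarith)
  have hi : ∀ p : ℝ, ∫ y in Ioi (0 : ℝ), (Real.exp (-(Real.cosh u + Real.cosh p) * y) : ℂ)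
      * Complex.exp (Complex.I * σ * p)
      = ((Real.cosh u + Real.cosh p)⁻¹ : ℝ) * Complex.exp (Complex.I * σ * p) := fun p => by
    rw [integral_mul_const, integral_complex_ofReal, integral_exp_neg_mul_Ioi (hpos p)]
  have hs := integral_integral_swap hInt
  simp_rw [hi] at hs
  have h2 : ∫ y in Ioi (0 : ℝ), ∫ p : ℝ, (Real.exp (-(Real.cosh u + Real.cosh p) * y) : ℂ)
      * Complex.exp (Complex.I * σ * p)
      = ((2 * ∫ y in Ioi (0 : ℝ), Real.exp (-Real.cosh u * y) * besselKi σ y : ℝ) : ℂ) := by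
    rw [← integral_const_mul, ← integral_complex_ofReal]
    refine setIntegral_congr_fun measurableSet_Ioi fun y hy => ?_
    rw [mul_left_comm, Complex.ofReal_mul, besselKi_eq_integral_cexp hy, ← integral_const_mul]
    congr 1
    ext p
    rw [← mul_assoc, ← Complex.ofReal_mul, ← Real.exp_add]
    congr 4
    ring
  rw [h2] at hs
  have h3 : ((Real.sinh u * (2 * ∫ y in Ioi (0 : ℝ), Real.exp (-Real.cosh u * y) * besselKi σ y)
      : ℝ) : ℂ) = ((2 * Real.pi * Real.sin (σ * u) / Real.sinh (Real.pi * σ) : ℝ) : ℂ) := by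
    rw [← h, Complex.ofReal_mul, hs, ← integral_const_mul]
    congr 1
    ext p
    rw [div_eq_mul_inv, Complex.ofReal_mul]
    ring
  have h4 := Complex.ofReal_injective h3
  linear_combination h4 / 2

lemma norm_Gamma_le_Gamma_re {s : ℂ} (hs : 0 < s.re) : ‖Complex.Gamma s‖ ≤ Real.Gamma s.re := by
  rw [Complex.Gamma_eq_integral hs, Complex.GammaIntegral, Real.Gamma_eq_integral hs]
  refine (norm_integral_le_integral_norm _).trans (le_of_eq ?_)
  refine setIntegral_congr_fun measurableSet_Ioi fun x hx => ?_
  rw [mem_Ioi] at hx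
  simp only [norm_mul, Complex.norm_real, Real.norm_of_nonneg (Real.exp_pos _).le]
  rw [Complex.norm_cpow_eq_rpow_re_of_pos hx]
  simp

lemma norm_Gamma_le_div {s : ℂ} (hs : 0 < s.re) :
    ‖Complex.Gamma s‖ ≤ Real.Gamma (s.re + 1) / ‖s‖ := by
  have h0 : s ≠ 0 := fun h => by simp [h] at hs
  rw [le_div_iff₀ (norm_pos_iff.2 h0), mul_comm, ← norm_mul, ← Complex.Gamma_add_one s h0]
  have : 0 < (s + 1).re := by simp; linarith
  simpa using norm_Gamma_le_Gamma_re this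

lemma continuous_Gamma_vertical {σ : ℝ} (hσ : 0 < σ) :
    Continuous fun u : ℝ => Complex.Gamma (σ + u * Complex.I) := by
  refine continuous_iff_continuousAt.2 fun u => ?_
  have h : DifferentiableAt ℂ Complex.Gamma (σ + u * Complex.I) :=
    Complex.differentiableAt_Gamma _ fun m h => by
      have := congrArg Complex.re h
      simp at this
      linarith
  exact ContinuousAt.comp (f := fun u : ℝ => (σ + u * Complex.I : ℂ)) h.continuousAt (by fun_prop)

lemma integrable_Gamma_mul_Gamma {σ : ℝ} (hσ : 0 < σ) :
    Integrable fun u : ℝ => Complex.Gamma (σ + u * Complex.I)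
      * Complex.Gamma (1 / 2 + (σ + u * Complex.I)) := by
  have e : ∀ u : ℝ, (1 / 2 + (σ + u * Complex.I) : ℂ)
      = ((σ + 1 / 2 : ℝ) : ℂ) + u * Complex.I := fun u => by push_cast; ring
  simp_rw [e]
  refine (integrable_inv_one_add_sq.const_mul
    (Real.Gamma (σ + 1) * Real.Gamma (σ + 1 / 2 + 1) * (1 + (σ ^ 2)⁻¹))).mono'
    ((continuous_Gamma_vertical hσ).mul
      (continuous_Gamma_vertical (by linarith))).aestronglyMeasurable
    (Eventually.of_forall fun u => ?_)
  have n : ∀ a : ℝ, ‖(a + u * Complex.I : ℂ)‖ = Real.sqrt (a ^ 2 + u ^ 2) := fun a =>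
    Complex.norm_add_mul_I a u
  have h1 := norm_Gamma_le_div (s := σ + u * Complex.I) (by simpa using hσ)
  have h2 := norm_Gamma_le_div (s := ((σ + 1 / 2 : ℝ) : ℂ) + u * Complex.I)
    (by rw [Complex.add_re, Complex.ofReal_re]; simp; linarith)
  rw [n] at h1 h2
  have r1 : (σ + u * Complex.I : ℂ).re = σ := by simp
  have r2 : (((σ + 1 / 2 : ℝ) : ℂ) + u * Complex.I : ℂ).re = σ + 1 / 2 := by simp
  rw [r1] at h1
  rw [r2] at h2
  have g1 : 0 < Real.Gamma (σ + 1) := Real.Gamma_pos_of_pos (by linarith)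
  have g2 : 0 < Real.Gamma (σ + 1 / 2 + 1) := Real.Gamma_pos_of_pos (by linarith)
  have q : 0 < σ ^ 2 + u ^ 2 := by positivity
  have q1 : 0 < Real.sqrt (σ ^ 2 + u ^ 2) := Real.sqrt_pos.2 q
  have h3 : Real.Gamma (σ + 1 / 2 + 1) / Real.sqrt ((σ + 1 / 2) ^ 2 + u ^ 2)
      ≤ Real.Gamma (σ + 1 / 2 + 1) / Real.sqrt (σ ^ 2 + u ^ 2) := by
    gcongr
    linarith
  rw [norm_mul]
  calc _ ≤ (Real.Gamma (σ + 1) / Real.sqrt (σ ^ 2 + u ^ 2))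
        * (Real.Gamma (σ + 1 / 2 + 1) / Real.sqrt (σ ^ 2 + u ^ 2)) :=
        mul_le_mul h1 (h2.trans h3) (norm_nonneg _) (by positivity)
    _ = Real.Gamma (σ + 1) * Real.Gamma (σ + 1 / 2 + 1) * (σ ^ 2 + u ^ 2)⁻¹ := by
        rw [div_mul_div_comm, Real.mul_self_sqrt q.le, div_eq_mul_inv]
    _ ≤ _ := by
        rw [mul_assoc _ _ (1 + u ^ 2)⁻¹]
        gcongr
        rw [← div_eq_mul_inv, le_div_iff₀ (by positivity), inv_mul_le_iff₀ q]
        have : 0 ≤ (σ ^ 2)⁻¹ * u ^ 2 := by positivity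
        have h5 : σ ^ 2 * (σ ^ 2)⁻¹ = 1 := mul_inv_cancel₀ (by positivity)
        nlinarith [sq_nonneg u, sq_nonneg σ]

lemma mellin_exp_neg_sqrt {s : ℂ} (hs : 0 < s.re) :
    MellinConvergent (fun x : ℝ => (Real.exp (-(2 * x ^ (1 / 2 : ℝ))) : ℂ)) s ∧
    Real.sqrt Real.pi * mellin (fun x : ℝ => (Real.exp (-(2 * x ^ (1 / 2 : ℝ))) : ℂ)) s
      = Complex.Gamma s * Complex.Gamma (1 / 2 + s) := by
  have h2 : 0 < (s / ((1 / 2 : ℝ) : ℂ)).re := by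
    rw [Complex.div_ofReal_re]; linarith
  have e2 : s / ((1 / 2 : ℝ) : ℂ) = 2 * s := by push_cast; ring
  constructor
  · rw [MellinConvergent.comp_rpow (f := fun x : ℝ => (Real.exp (-(2 * x)) : ℂ)) (by norm_num),
      MellinConvergent.comp_mul_left (f := fun x : ℝ => (Real.exp (-x) : ℂ)) two_pos]
    simpa [MellinConvergent, mul_comm] using Complex.GammaIntegral_convergent h2
  · rw [mellin_comp_rpow (fun x : ℝ => (Real.exp (-(2 * x)) : ℂ)),
      mellin_comp_mul_left (fun x : ℝ => (Real.exp (-x) : ℂ)) _ two_pos,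
      ← Complex.GammaIntegral_eq_mellin, ← Complex.Gamma_eq_integral h2, e2, add_comm (1 / 2) s,
      Complex.Gamma_mul_Gamma_add_half, sub_eq_add_neg, Complex.cpow_add _ _ two_ne_zero]
    rw [abs_of_pos (by norm_num)]
    simp
    ring

lemma integral_Gamma_mul_Gamma_mul_cpow {σ x : ℝ} (hσ : 0 < σ) (hx : 0 < x) :
    (1 / (2 * (Real.pi : ℂ))) * ∫ u : ℝ, Complex.Gamma (σ + u * Complex.I)
      * Complex.Gamma (1 / 2 + (σ + u * Complex.I)) * (x : ℂ) ^ (-(σ + u * Complex.I))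
      = ((Real.sqrt Real.pi * Real.exp (-(2 * x ^ (1 / 2 : ℝ))) : ℝ) : ℂ) := by
  have hπ : ((Real.sqrt Real.pi : ℝ) : ℂ) ≠ 0 :=
    Complex.ofReal_ne_zero.2 (Real.sqrt_pos.2 Real.pi_pos).ne'
  have hre : ∀ u : ℝ, 0 < (σ + u * Complex.I : ℂ).re := fun u => by simpa using hσ
  have hm : ∀ u : ℝ, mellin (fun x : ℝ => (Real.exp (-(2 * x ^ (1 / 2 : ℝ))) : ℂ))
      (σ + u * Complex.I) = (Real.sqrt Real.pi : ℂ)⁻¹ * (Complex.Gamma (σ + u * Complex.I)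
        * Complex.Gamma (1 / 2 + (σ + u * Complex.I))) := fun u => by
    rw [← (mellin_exp_neg_sqrt (hre u)).2, inv_mul_cancel_left₀ hπ]
  have h := mellinInv_mellin_eq σ (fun x : ℝ => (Real.exp (-(2 * x ^ (1 / 2 : ℝ))) : ℂ)) hx
    (mellin_exp_neg_sqrt (by simpa using hσ)).1 ?_ ?_
  · rw [Complex.ofReal_mul, ← h, mellinInv]
    simp_rw [hm]
    rw [Complex.real_smul, mul_left_comm, ← integral_const_mul (Real.sqrt Real.pi : ℂ)]
    congr 1
    · push_cast
      rfl
    · congr 1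
      ext u
      rw [smul_eq_mul]
      field_simp
  · unfold Complex.VerticalIntegrable
    simp_rw [hm]
    exact (integrable_Gamma_mul_Gamma hσ).const_mul _
  · have : ContinuousAt (fun x : ℝ => x ^ (1 / 2 : ℝ)) x :=
      Real.continuousAt_rpow_const _ _ (Or.inl hx.ne')
    fun_prop

/-- The Mellin-Barnes side as a Laplace-type transform of `f`. -/
lemma mellin_barnes_eq {ν t : ℝ} (hν : ν < 1) (ht : 0 < t) {f : ℝ → ℝ}
    (hf : IntegrableOn (fun x => f x * x ^ (ν - 1)) (Ioi 0)) :
    (1 / (2 * (Real.pi : ℂ))) * (∫ u : ℝ,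
        Complex.Gamma (((1 - ν : ℝ) : ℂ) + (u : ℂ) * Complex.I)
        * Complex.Gamma (1 / 2 + (((1 - ν : ℝ) : ℂ) + (u : ℂ) * Complex.I))
        * mellinT f (1 - (((1 - ν : ℝ) : ℂ) + (u : ℂ) * Complex.I))
        * (t : ℂ) ^ (-(((1 - ν : ℝ) : ℂ) + (u : ℂ) * Complex.I)))
      = ((Real.sqrt Real.pi * ∫ x in Ioi (0 : ℝ), Real.exp (-(2 * (t * x) ^ (1 / 2 : ℝ))) * f x
        : ℝ) : ℂ) := by
  set σ := 1 - ν with hσd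
  have hσ : 0 < σ := by linarith
  set G : ℝ → ℂ := fun u => Complex.Gamma (σ + u * Complex.I)
        * Complex.Gamma (1 / 2 + (σ + u * Complex.I)) with hG
  have h1 : ∀ u : ℝ, G u * mellinT f (1 - (σ + u * Complex.I)) * (t : ℂ) ^ (-(σ + u * Complex.I))
      = ∫ x in Ioi (0 : ℝ), (f x : ℂ) * (G u * ((t * x : ℝ) : ℂ) ^ (-(σ + u * Complex.I))) := by
    intro u
    rw [mellinT, mul_right_comm, ← integral_const_mul]
    refine setIntegral_congr_fun measurableSet_Ioi fun x hx => ?_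
    rw [mem_Ioi] at hx
    rw [Complex.ofReal_mul, Complex.mul_cpow_ofReal_nonneg ht.le hx.le]
    ring_nf
  have hInt : Integrable (Function.uncurry fun u x : ℝ =>
      (f x : ℂ) * (G u * ((t * x : ℝ) : ℂ) ^ (-(σ + u * Complex.I))))
      (volume.prod (volume.restrict (Ioi 0))) := by
    have hpos : ∀ᵐ z ∂((volume : Measure ℝ).prod ((volume : Measure ℝ).restrict (Ioi 0))),
        0 < z.2 := Measure.quasiMeasurePreserving_snd.ae (ae_restrict_mem measurableSet_Ioi)
    have hp : Integrable (fun z : ℝ × ℝ => G z.1 * ((f z.2 * z.2 ^ (ν - 1) : ℝ) : ℂ))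
        (volume.prod (volume.restrict (Ioi 0))) :=
      (integrable_Gamma_mul_Gamma hσ).mul_prod hf.ofReal
    refine ((hp.mul_bdd (c := 1) (g := fun z : ℝ × ℝ =>
      ((t * z.2 : ℝ) : ℂ) ^ (-(z.1 * Complex.I))) ?_ ?_).mul_const ((t : ℂ) ^ (-σ : ℂ))).congr ?_
    · exact (Measurable.pow (by fun_prop) (by fun_prop)).aestronglyMeasurable
    · filter_upwards [hpos] with z hz
      rw [Complex.norm_cpow_eq_rpow_re_of_pos (mul_pos ht hz)]
      simp
    · filter_upwards [hpos] with z hz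
      have hz' : (z.2 : ℂ) ≠ 0 := by exact_mod_cast hz.ne'
      have ht' : (t : ℂ) ≠ 0 := by exact_mod_cast ht.ne'
      have e1 : ν - 1 = -σ := by rw [hσd]; ring
      simp only [Function.uncurry]
      rw [e1, neg_add, Complex.cpow_add _ _ (by exact_mod_cast (mul_pos ht hz).ne'),
        Complex.ofReal_mul, Complex.ofReal_cpow hz.le, Complex.ofReal_mul,
        Complex.mul_cpow_ofReal_nonneg ht.le hz.le, Complex.mul_cpow_ofReal_nonneg ht.le hz.le,
        Complex.ofReal_neg]
      ring
  calc _ = (1 / (2 * (Real.pi : ℂ))) * ∫ u : ℝ, ∫ x in Ioi (0 : ℝ),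
        (f x : ℂ) * (G u * ((t * x : ℝ) : ℂ) ^ (-(σ + u * Complex.I))) := by
        simp_rw [← h1, hG]
    _ = ∫ x in Ioi (0 : ℝ), (1 / (2 * (Real.pi : ℂ))) * ∫ u : ℝ,
        (f x : ℂ) * (G u * ((t * x : ℝ) : ℂ) ^ (-(σ + u * Complex.I))) := by
        rw [integral_integral_swap hInt, integral_const_mul]
    _ = _ := by
        rw [← integral_const_mul, ← integral_complex_ofReal]
        refine setIntegral_congr_fun measurableSet_Ioi fun x hx => ?_
        rw [integral_const_mul, mul_left_comm, integral_Gamma_mul_Gamma_mul_cpow hσ (mul_pos ht hx)]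
        push_cast
        ring

lemma cosh_add_mul_I (b θ : ℝ) : Complex.cosh (b + θ * Complex.I)
    = ((Real.cosh b * Real.cos θ : ℝ) : ℂ) + ((Real.sinh b * Real.sin θ : ℝ) : ℂ) * Complex.I := by
  rw [Complex.cosh_add, Complex.cosh_mul_I, Complex.sinh_mul_I]
  push_cast
  ring

lemma norm_cexp_neg_mul_cosh (k b θ : ℝ) :
    ‖Complex.exp (-k * Complex.cosh (b + θ * Complex.I))‖
      = Real.exp (-(k * Real.cos θ) * Real.cosh b) := by
  rw [cosh_add_mul_I, Complex.norm_exp]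
  congr 1
  simp [-Complex.ofReal_cosh, -Complex.ofReal_sinh, -Complex.ofReal_cos, -Complex.ofReal_sin]
  ring

lemma norm_sinh_add_mul_I_le (b θ : ℝ) :
    ‖Complex.sinh (b + θ * Complex.I)‖ ≤ 2 * Real.cosh b := by
  have hb : |Real.sinh b| ≤ Real.cosh b := by
    rw [Real.abs_sinh, ← Real.cosh_abs b]; exact (Real.sinh_lt_cosh _).le
  rw [Complex.sinh_add, Complex.cosh_mul_I, Complex.sinh_mul_I, ← Complex.ofReal_sinh,
    ← Complex.ofReal_cosh, ← Complex.ofReal_cos, ← Complex.ofReal_sin]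
  refine (norm_add_le _ _).trans ?_
  simp only [norm_mul, Complex.norm_real, Complex.norm_I, Real.norm_eq_abs, mul_one,
    abs_of_pos (Real.cosh_pos b)]
  have h1 : |Real.sinh b| * |Real.cos θ| ≤ Real.cosh b * 1 := by
    gcongr
    exact Real.abs_cos_le_one _
  have h2 : Real.cosh b * |Real.sin θ| ≤ Real.cosh b * 1 := by
    gcongr
    exact Real.abs_sin_le_one _
  linarith

lemma integrable_cexp_neg_mul_cosh {k θ : ℝ} (hk : 0 < k)
    (hθ : θ ∈ Ioo (-(Real.pi / 2)) (Real.pi / 2)) :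
    Integrable fun b : ℝ => Complex.exp (-k * Complex.cosh (b + θ * Complex.I)) := by
  refine (integrable_exp_neg_mul_cosh (mul_pos hk (Real.cos_pos_of_mem_Ioo hθ))).mono'
    (by fun_prop) (Eventually.of_forall fun b => (norm_cexp_neg_mul_cosh k b θ).le)

lemma norm_sinh_mul_cexp_le {k b θ c : ℝ} (hk : 0 < k) (hc : c ≤ Real.cos θ) :
    ‖-(k * Complex.sinh (b + θ * Complex.I))
      * Complex.exp (-k * Complex.cosh (b + θ * Complex.I))‖
      ≤ (2 * k) * (Real.cosh b * Real.exp (-(k * c) * Real.cosh b)) := by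
  rw [norm_mul, norm_cexp_neg_mul_cosh, norm_neg, norm_mul, Complex.norm_real,
    Real.norm_of_nonneg hk.le]
  calc _ ≤ (k * (2 * Real.cosh b)) * Real.exp (-(k * c) * Real.cosh b) := by
        gcongr
        exact norm_sinh_add_mul_I_le b θ
    _ = _ := by ring

/-- Rotating the line of integration does not change `∫ exp (-k cosh b) db`. -/
lemma integral_cexp_neg_mul_cosh_add {k θ : ℝ} (hk : 0 < k)
    (hθ : θ ∈ Ioo (-(Real.pi / 2)) (Real.pi / 2)) :
    ∫ b : ℝ, Complex.exp (-k * Complex.cosh (b + θ * Complex.I))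
      = ((∫ b : ℝ, Real.exp (-k * Real.cosh b) : ℝ) : ℂ) := by
  have hd : ∀ b θ : ℝ, HasDerivAt (fun w : ℂ => Complex.exp (-k * Complex.cosh w))
      (-(k * Complex.sinh (b + θ * Complex.I))
        * Complex.exp (-k * Complex.cosh (b + θ * Complex.I))) (b + θ * Complex.I) := by
    intro b θ
    refine (((Complex.hasDerivAt_cosh _).const_mul (-k : ℂ)).cexp).congr_deriv ?_
    ring
  have hmain : ∀ θ ∈ Ioo (-(Real.pi / 2)) (Real.pi / 2), HasDerivAt (fun θ : ℝ =>
      ∫ b : ℝ, Complex.exp (-k * Complex.cosh (b + θ * Complex.I))) 0 θ := by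
    intro θ hθ
    have hcos := Real.cos_pos_of_mem_Ioo hθ
    have hs : Ioo (-(Real.pi / 2)) (Real.pi / 2) ∩ {t | Real.cos θ / 2 < Real.cos t}
        ∈ nhds θ :=
      inter_mem (isOpen_Ioo.mem_nhds hθ) ((isOpen_lt continuous_const Real.continuous_cos).mem_nhds
        (by change Real.cos θ / 2 < Real.cos θ; linarith))
    have key := hasDerivAt_integral_of_dominated_loc_of_deriv_le (μ := volume) (𝕜 := ℝ)
      (F := fun θ b : ℝ => Complex.exp (-k * Complex.cosh (b + θ * Complex.I)))
      (F' := fun θ b : ℝ => (-(k * Complex.sinh (b + θ * Complex.I))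
        * Complex.exp (-k * Complex.cosh (b + θ * Complex.I))) * Complex.I)
      (x₀ := θ) (bound := fun b => (2 * k) * (Real.cosh b
        * Real.exp (-(k * (Real.cos θ / 2)) * Real.cosh b))) hs
      (Eventually.of_forall fun θ => by fun_prop) (integrable_cexp_neg_mul_cosh hk hθ)
      (by fun_prop) (Eventually.of_forall fun b t ht => by
        rw [norm_mul, Complex.norm_I, mul_one]
        exact norm_sinh_mul_cexp_le hk ht.2.le)
      ((integrable_cosh_mul_exp_neg_mul_cosh (by positivity)).const_mul _)
      (Eventually.of_forall fun b t ht => by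
        have h1 : HasDerivAt (fun t : ℝ => (b + t * Complex.I : ℂ)) Complex.I t := by
          simpa using
            ((Complex.ofRealCLM.hasDerivAt (x := t)).mul_const Complex.I).const_add (b : ℂ)
        exact HasDerivAt.comp (h := fun t : ℝ => (b + t * Complex.I : ℂ))
          (h₂ := fun w : ℂ => Complex.exp (-k * Complex.cosh w)) t (hd b t) h1)
    have hz : ∫ b : ℝ, -(k * Complex.sinh (b + θ * Complex.I))
        * Complex.exp (-k * Complex.cosh (b + θ * Complex.I)) = 0 := by
      refine integral_eq_zero_of_hasDerivAt_of_integrable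
        (f := fun b : ℝ => Complex.exp (-k * Complex.cosh (b + θ * Complex.I))) (fun b => ?_) ?_
        (integrable_cexp_neg_mul_cosh hk hθ)
      · have h1 : HasDerivAt (fun b : ℝ => (b + θ * Complex.I : ℂ)) 1 b := by
          simpa using (Complex.ofRealCLM.hasDerivAt (x := b)).add_const (θ * Complex.I : ℂ)
        simpa [Function.comp_def] using HasDerivAt.comp (h := fun b : ℝ => (b + θ * Complex.I : ℂ))
          (h₂ := fun w : ℂ => Complex.exp (-k * Complex.cosh w)) b (hd b θ) h1
      · exact ((integrable_cosh_mul_exp_neg_mul_cosh (mul_pos hk hcos)).const_mul (2 * k)).mono'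
          (by fun_prop) (Eventually.of_forall fun b => norm_sinh_mul_cexp_le hk le_rfl)
    refine key.2.congr_deriv ?_
    rw [integral_mul_const, hz, zero_mul]
  have h0 : (0 : ℝ) ∈ Ioo (-(Real.pi / 2)) (Real.pi / 2) := by
    constructor <;> linarith [Real.pi_pos]
  have hc := isOpen_Ioo.is_const_of_deriv_eq_zero isPreconnected_Ioo
    (fun t ht => (hmain t ht).differentiableAt.differentiableWithinAt)
    (fun t ht => (hmain t ht).deriv) hθ h0
  rw [hc, ← integral_complex_ofReal]
  simp

lemma integral_cexp_neg_add_conj {P : ℂ} (hP : 0 < P.re) :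
    ∫ b : ℝ, Complex.exp (-(P * Real.exp b + (starRingEnd ℂ) P * Real.exp (-b)))
      = ((∫ b : ℝ, Real.exp (-(2 * ‖P‖) * Real.cosh b) : ℝ) : ℂ) := by
  have hP0 : P ≠ 0 := fun h => by simp [h] at hP
  have harg := abs_lt.1 (Complex.abs_arg_lt_pi_div_two_iff.2 (Or.inl hP))
  rw [← integral_cexp_neg_mul_cosh_add (by positivity) harg]
  congr 1
  ext b
  congr 1
  have h1 := (Complex.norm_mul_exp_arg_mul_I P).symm
  have h2 : (starRingEnd ℂ) P = ‖P‖ * Complex.exp (-(P.arg * Complex.I)) := by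
    conv_lhs => rw [h1]
    rw [map_mul, Complex.conj_ofReal, ← Complex.exp_conj]
    simp
  rw [h2]
  nth_rw 1 [h1]
  rw [Complex.cosh, neg_add (b : ℂ), Complex.exp_add, Complex.exp_add]
  push_cast
  ring

/-- The two-sided exponential integral in multiplicative form. -/
lemma integral_exp_neg_mul_cosh_eq {c r : ℝ} (hc : 0 < c) (hr : 0 < r) :
    ∫ b : ℝ, Real.exp (-(2 * (r * Real.sqrt c)) * Real.cosh b)
      = ∫ y in Ioi (0 : ℝ), Real.exp (-y * c) * (Real.exp (-(r ^ 2 / y)) * y⁻¹) := by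
  rw [integral_Ioi_eq_integral_exp, ← integral_add_right_eq_self (fun b : ℝ =>
    Real.exp b • (Real.exp (-Real.exp b * c) * (Real.exp (-(r ^ 2 / Real.exp b)) *
      (Real.exp b)⁻¹))) (Real.log (r / Real.sqrt c))]
  congr 1
  ext b
  rw [Real.exp_add, Real.exp_log (by positivity), smul_eq_mul, Real.cosh_eq, Real.exp_neg b]
  rw [← mul_assoc, mul_comm (Real.exp b * _), mul_assoc, mul_assoc,
    inv_mul_cancel_right₀ (by positivity),
    ← Real.exp_add]
  congr 1
  field_simp
  rw [Real.sq_sqrt hc.le]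
  ring

lemma integrable_exp_neg_mul_cosh_prod :
    Integrable (Function.uncurry fun y p : ℝ => Real.exp (-y * Real.cosh p))
      ((volume.restrict (Ioi 0)).prod volume) := by
  have hc : Continuous (Function.uncurry fun y p : ℝ => Real.exp (-y * Real.cosh p)) := by
    unfold Function.uncurry
    fun_prop
  have e : ∀ p y : ℝ, Real.exp (-y * Real.cosh p) = Real.exp (-Real.cosh p * y) := fun p y => by
    congr 1; ring
  rw [integrable_prod_iff' hc.aestronglyMeasurable]
  constructor
  · refine Eventually.of_forall fun p => ?_
    have : IntegrableOn (fun y : ℝ => Real.exp (-y * Real.cosh p)) (Ioi 0) := by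
      simp_rw [e]
      exact exp_neg_integrableOn_Ioi 0 (Real.cosh_pos p)
    exact this
  · simp only [Function.uncurry, Real.norm_of_nonneg (Real.exp_pos _).le, e,
      integral_exp_neg_mul_Ioi (Real.cosh_pos _)]
    exact integrable_inv_cosh

lemma integral_eq_integral_Ioi_add_neg {g : ℝ → ℂ} (hg : Integrable g) :
    ∫ p, g p = ∫ p in Ioi (0 : ℝ), (g p + g (-p)) := by
  rw [integral_add hg.integrableOn hg.comp_neg.integrableOn, integral_comp_neg_Ioi, neg_zero,
    add_comm, intervalIntegral.integral_Iic_add_Ioi hg.integrableOn hg.integrableOn]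

lemma norm_cexp_neg_mul_cosh_real (z : ℂ) (p : ℝ) :
    ‖Complex.exp (-z * (Real.cosh p : ℂ))‖ = Real.exp (-z.re * Real.cosh p) := by
  rw [Complex.norm_exp, Complex.re_mul_ofReal, Complex.neg_re]

lemma integrable_cexp_neg_mul_cosh_mul_cexp {z : ℂ} (hz : 0 < z.re) (σ : ℝ) :
    Integrable fun p : ℝ => Complex.exp (-z * (Real.cosh p : ℂ)) *
      Complex.exp (Complex.I * σ * p) := by
  refine (integrable_exp_neg_mul_cosh hz).mono' (by fun_prop) (Eventually.of_forall fun p => ?_)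
  rw [norm_mul, norm_cexp_I_mul, mul_one, norm_cexp_neg_mul_cosh_real]

lemma two_mul_besselK_eq {z : ℂ} (hz : 0 < z.re) (τ : ℝ) :
    2 * besselK (2 * Complex.I * τ) z = ∫ p : ℝ, Complex.exp (-z * (Real.cosh p : ℂ)) *
      Complex.exp (Complex.I * (2 * τ : ℝ) * p) := by
  rw [integral_eq_integral_Ioi_add_neg (integrable_cexp_neg_mul_cosh_mul_cexp hz (2 * τ)), besselK,
    ← integral_const_mul]
  congr 1
  ext p
  rw [Complex.cosh, Real.cosh_neg]
  push_cast
  ring_nf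

/-- Product formula for the two Bessel functions at conjugate arguments. -/
lemma besselK_mul_besselK_conj {r : ℝ} (hr : 0 < r) (τ : ℝ) :
    besselK (2 * Complex.I * τ) (r + r * Complex.I)
        * besselK (2 * Complex.I * τ) (r - r * Complex.I)
      = ((1 / 2 * ∫ y in Ioi (0 : ℝ), besselKi (2 * τ) y * (Real.exp (-(r ^ 2 / y)) * y⁻¹) : ℝ)
        : ℂ) := by
  have hz1 : 0 < (r + r * Complex.I : ℂ).re := by simpa using hr
  have hz2 : 0 < (r - r * Complex.I : ℂ).re := by simpa using hr
  have hconv := integral_convolution (ContinuousLinearMap.mul ℂ ℂ)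
    (integrable_cexp_neg_mul_cosh_mul_cexp hz2 (2 * τ))
    (integrable_cexp_neg_mul_cosh_mul_cexp hz1 (2 * τ))
  rw [ContinuousLinearMap.mul_apply', ← two_mul_besselK_eq hz1, ← two_mul_besselK_eq hz2] at hconv
  have hc : ∀ v : ℝ, convolution (fun p : ℝ => Complex.exp (-(r - r * Complex.I) *
        (Real.cosh p : ℂ)) * Complex.exp (Complex.I * (2 * τ : ℝ) * p))
      (fun p : ℝ => Complex.exp (-(r + r * Complex.I) *
        (Real.cosh p : ℂ)) * Complex.exp (Complex.I * (2 * τ : ℝ) * p))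
      (ContinuousLinearMap.mul ℂ ℂ) volume v
      = ∫ y in Ioi (0 : ℝ), ((Real.exp (-y * Real.cosh v) * (Real.exp (-(r ^ 2 / y)) * y⁻¹) : ℝ)
        : ℂ) * Complex.exp (Complex.I * (2 * τ : ℝ) * v) := by
    intro v
    set P : ℂ := r * (Real.cosh (v / 2) - Real.sinh (v / 2) * Complex.I) with hP
    have hPre : P.re = r * Real.cosh (v / 2) := by
      rw [hP, Complex.re_ofReal_mul]
      simp [-Complex.ofReal_cosh, -Complex.ofReal_sinh]
    have hPim : P.im = -(r * Real.sinh (v / 2)) := by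
      rw [hP, Complex.im_ofReal_mul]
      simp [-Complex.ofReal_cosh, -Complex.ofReal_sinh]
    have hPpos : 0 < P.re := by
      rw [hPre]
      exact mul_pos hr (Real.cosh_pos _)
    have hPn : ‖P‖ = r * Real.sqrt (Real.cosh v) := by
      rw [Complex.norm_eq_sqrt_sq_add_sq, hPre, hPim,
        Real.sqrt_eq_iff_mul_self_eq (by positivity) (by positivity)]
      rw [mul_mul_mul_comm, Real.mul_self_sqrt (Real.cosh_pos _).le]
      have := Real.cosh_two_mul (v / 2)
      rw [show 2 * (v / 2) = v by ring] at this
      rw [this]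
      ring
    rw [integral_mul_const, integral_complex_ofReal,
      ← integral_exp_neg_mul_cosh_eq (Real.cosh_pos v) hr,
      ← hPn, ← integral_cexp_neg_add_conj hPpos, ← integral_mul_const, convolution,
      ← integral_add_right_eq_self _ (v / 2)]
    congr 1
    ext b
    rw [ContinuousLinearMap.mul_apply', mul_mul_mul_comm, ← Complex.exp_add, ← Complex.exp_add]
    have hconj : (starRingEnd ℂ) P = r * (Real.cosh (v / 2) + Real.sinh (v / 2) * Complex.I) := by
      rw [hP, map_mul, map_sub, map_mul, Complex.conj_ofReal, Complex.conj_ofReal,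
        Complex.conj_ofReal, Complex.conj_I]
      ring
    rw [hconj, hP, show v - (b + v / 2) = v / 2 - b by ring, Real.cosh_add, Real.cosh_sub,
      Real.cosh_eq b, Real.sinh_eq b]
    congr 2
    · push_cast
      ring
    · push_cast
      ring
  simp_rw [hc] at hconv
  have hInt : Integrable (Function.uncurry fun v y : ℝ =>
      ((Real.exp (-y * Real.cosh v) * (Real.exp (-(r ^ 2 / y)) * y⁻¹) : ℝ) : ℂ)
        * Complex.exp (Complex.I * (2 * τ : ℝ) * v))
      (volume.prod (volume.restrict (Ioi 0))) := by
    have hpos : ∀ᵐ z ∂((volume : Measure ℝ).prod ((volume : Measure ℝ).restrict (Ioi 0))),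
        0 < z.2 := Measure.quasiMeasurePreserving_snd.ae (ae_restrict_mem measurableSet_Ioi)
    have h1 : Integrable (fun z : ℝ × ℝ => Real.exp (-z.2 * Real.cosh z.1)
        * (Real.exp (-(r ^ 2 / z.2)) * z.2⁻¹)) (volume.prod (volume.restrict (Ioi 0))) := by
      refine integrable_exp_neg_mul_cosh_prod.swap.mul_bdd (c := (r ^ 2)⁻¹)
        (Measurable.aestronglyMeasurable (by fun_prop)) ?_
      filter_upwards [hpos] with z hz
      rw [Real.norm_of_nonneg (by positivity)]
      calc _ ≤ (r ^ 2 / z.2)⁻¹ * z.2⁻¹ := by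
            gcongr
            exact exp_neg_le_inv (by positivity)
        _ = _ := by field_simp
    exact h1.ofReal.mul_bdd (c := 1) (by fun_prop)
      (Eventually.of_forall fun z => (norm_cexp_I_mul (2 * τ) z.1).le)
  rw [integral_integral_swap hInt] at hconv
  have h2 : ∫ y in Ioi (0 : ℝ), ∫ v : ℝ,
      ((Real.exp (-y * Real.cosh v) * (Real.exp (-(r ^ 2 / y)) * y⁻¹) : ℝ) : ℂ)
        * Complex.exp (Complex.I * (2 * τ : ℝ) * v)
      = ((2 * ∫ y in Ioi (0 : ℝ), besselKi (2 * τ) y * (Real.exp (-(r ^ 2 / y)) * y⁻¹) : ℝ)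
        : ℂ) := by
    rw [← integral_const_mul, ← integral_complex_ofReal]
    refine setIntegral_congr_fun measurableSet_Ioi fun y hy => ?_
    rw [← mul_assoc, Complex.ofReal_mul (2 * besselKi (2 * τ) y), besselKi_eq_integral_cexp hy,
      ← integral_mul_const]
    congr 1
    ext v
    push_cast
    ring
  rw [h2] at hconv
  rw [Complex.ofReal_mul] at hconv ⊢
  push_cast
  push_cast at hconv
  linear_combination -hconv / 4

lemma kernelK_eq {x : ℝ} (hx : 0 < x) (τ : ℝ) :
    kernelK x τ = 1 / 2 * ∫ y in Ioi (0 : ℝ),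
      besselKi (2 * τ) y * (Real.exp (-(4 * x ^ (1 / 2 : ℝ) / y)) * y⁻¹) := by
  set w : ℝ := 2 * (4 * x) ^ ((1 : ℝ) / 4) with hw
  have h2 : Real.sqrt 2 * Real.sqrt 2 = 2 := Real.mul_self_sqrt (by norm_num)
  set r : ℝ := w * (Real.sqrt 2 / 2) with hr
  have hrpos : 0 < r := by positivity
  have hr2 : r ^ 2 = 4 * x ^ (1 / 2 : ℝ) := by
    have h4 : ((4 : ℝ)) ^ ((1 : ℝ) / 2) = 2 := by
      rw [← Real.sqrt_eq_rpow, show (4 : ℝ) = 2 ^ 2 by norm_num, Real.sqrt_sq (by norm_num)]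
    have hw2 : ((4 * x) ^ ((1 : ℝ) / 4)) ^ 2 = 2 * x ^ (1 / 2 : ℝ) := by
      rw [← Real.rpow_natCast, ← Real.rpow_mul (by positivity),
        show (1 : ℝ) / 4 * ((2 : ℕ) : ℝ) = 1 / 2 by norm_num,
        Real.mul_rpow (by norm_num) hx.le, h4]
    rw [hr, hw, mul_pow, mul_pow, hw2]
    nlinarith
  have e1 : (w : ℂ) * Complex.exp (Complex.I * (Real.pi : ℂ) / 4) = r + r * Complex.I := by
    rw [show Complex.I * (Real.pi : ℂ) / 4 = ((Real.pi / 4 : ℝ) : ℂ) * Complex.I by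
      push_cast; ring, Complex.exp_mul_I, ← Complex.ofReal_cos, ← Complex.ofReal_sin,
      Real.cos_pi_div_four, Real.sin_pi_div_four, hr]
    push_cast
    ring
  have e2 : (w : ℂ) * Complex.exp (-(Complex.I * (Real.pi : ℂ)) / 4) = r - r * Complex.I := by
    rw [show -(Complex.I * (Real.pi : ℂ)) / 4 = ((-(Real.pi / 4) : ℝ) : ℂ) * Complex.I by
      push_cast; ring, Complex.exp_mul_I, ← Complex.ofReal_cos, ← Complex.ofReal_sin,
      Real.cos_neg, Real.sin_neg, Real.cos_pi_div_four, Real.sin_pi_div_four, hr]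
    push_cast
    ring
  rw [kernelK, ← hw, e1, e2, besselK_mul_besselK_conj hrpos, Complex.ofReal_re, hr2]

lemma ae_fst_pos : ∀ᵐ z ∂(((volume : Measure ℝ).restrict (Ioi 0)).prod (volume : Measure ℝ)),
    0 < z.1 := Measure.quasiMeasurePreserving_fst.ae (ae_restrict_mem measurableSet_Ioi)

lemma integrable_exp_neg_mul_cosh_mul {φ : ℝ → ℝ} {M : ℝ}
    (hφ : AEStronglyMeasurable φ (volume.restrict (Ioi 0))) (hM : ∀ y, 0 < y → |φ y| ≤ M) :
    Integrable (Function.uncurry fun y p : ℝ => Real.exp (-y * Real.cosh p) * φ y)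
      ((volume.restrict (Ioi 0)).prod volume) := by
  refine integrable_exp_neg_mul_cosh_prod.mul_bdd (c := M) (g := fun z : ℝ × ℝ => φ z.1)
    hφ.comp_fst ?_
  filter_upwards [ae_fst_pos] with z hz using hM _ hz

lemma integrable_exp_neg_mul_cosh_mul_cos {φ : ℝ → ℝ} {M : ℝ}
    (hφ : AEStronglyMeasurable φ (volume.restrict (Ioi 0))) (hM : ∀ y, 0 < y → |φ y| ≤ M) (σ : ℝ) :
    Integrable (Function.uncurry fun y p : ℝ =>
      Real.exp (-y * Real.cosh p) * φ y * Real.cos (σ * p))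
      ((volume.restrict (Ioi 0)).prod (volume.restrict (Ioi 0))) := by
  have h : Integrable (Function.uncurry fun y p : ℝ =>
      Real.exp (-y * Real.cosh p) * φ y * Real.cos (σ * p))
      ((volume.restrict (Ioi 0)).prod volume) :=
    (integrable_exp_neg_mul_cosh_mul hφ hM).mul_bdd (c := 1)
      (g := fun z : ℝ × ℝ => Real.cos (σ * z.2)) (by fun_prop)
      (Eventually.of_forall fun z => Real.abs_cos_le_one _)
  exact h.mono_measure (Measure.prod_mono le_rfl Measure.restrict_le_self)

lemma integrableOn_besselKi (σ : ℝ) : IntegrableOn (besselKi σ) (Ioi 0) := by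
  have h := (integrable_exp_neg_mul_cosh_mul_cos (φ := fun _ => 1) (M := 1)
    aestronglyMeasurable_const (by simp) σ).integral_prod_left
  refine h.congr (Eventually.of_forall fun y => ?_)
  simp [besselKi, Function.uncurry]

lemma integral_besselKi_mul {φ : ℝ → ℝ} {M : ℝ}
    (hφ : AEStronglyMeasurable φ (volume.restrict (Ioi 0))) (hM : ∀ y, 0 < y → |φ y| ≤ M) (σ : ℝ) :
    ∫ y in Ioi (0 : ℝ), besselKi σ y * φ y
      = ∫ p in Ioi (0 : ℝ), (∫ y in Ioi (0 : ℝ), Real.exp (-y * Real.cosh p) * φ y)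
        * Real.cos (σ * p) := by
  have h := integral_integral_swap (integrable_exp_neg_mul_cosh_mul_cos hφ hM σ)
  simp_rw [integral_mul_const] at h
  rw [← h]
  congr 1
  ext y
  rw [besselKi, ← integral_mul_const]
  congr 1
  ext p
  ring

lemma continuous_integral_mul_cos {H : ℝ → ℝ} {S : Set ℝ} (hH : IntegrableOn H S) :
    Continuous fun σ : ℝ => ∫ p in S, H p * Real.cos (σ * p) := by
  refine continuous_of_dominated (bound := fun p => ‖H p‖) (fun σ => ?_) (fun σ => ?_) hH.norm ?_
  · exact hH.aestronglyMeasurable.mul (by fun_prop)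
  · refine Eventually.of_forall fun p => ?_
    rw [norm_mul]
    exact mul_le_of_le_one_right (norm_nonneg _) (Real.abs_cos_le_one _)
  · exact Eventually.of_forall fun p => by fun_prop

open scoped FourierTransform in
/-- Fourier cosine inversion. -/
lemma eq_integral_mul_cos_of_cosine_transform {H A : ℝ → ℝ} (hH : Integrable H)
    (hHc : Continuous H) (heven : ∀ p, H (-p) = H p)
    (hA : ∀ τ, A τ = 1 / 2 * ∫ p in Ioi (0 : ℝ), H p * Real.cos (2 * τ * p))
    (hAi : IntegrableOn A (Ioi 0)) (p : ℝ) :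
    H p = 8 / Real.pi * ∫ τ in Ioi (0 : ℝ), A τ * Real.cos (2 * p * τ) := by
  have hAe : ∀ τ, A (-τ) = A τ := fun τ => by
    rw [hA, hA]
    congr 2
    ext p
    rw [← Real.cos_neg (2 * τ * p)]
    ring_nf
  have hAI : Integrable A := by
    have h1 : IntegrableOn A (Iic 0) := by
      have := (integrableOn_Ici_iff_integrableOn_Ioi (by simp)).2 hAi
      have h2 := (integrable_indicator_iff measurableSet_Ici).2 this
      have h3 := h2.comp_neg
      refine (integrable_indicator_iff measurableSet_Iic).1 (h3.congr (Eventually.of_forall ?_))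
      intro x
      by_cases hx : x ≤ 0
      · simp [indicator, hx, hAe]
      · simp [indicator, hx]
    have := h1.union hAi
    rwa [Iic_union_Ioi, integrableOn_univ] at this
  have hF : 𝓕 (fun p => (H p : ℂ)) = fun ξ => ((4 * A (Real.pi * ξ) : ℝ) : ℂ) := by
    ext ξ
    rw [Real.fourier_real_eq_integral_exp_smul, ← hAe (Real.pi * ξ), hA]
    have := integral_even_mul_cexp hH heven (2 * -(Real.pi * ξ))
    rw [show 4 * (1 / 2 * ∫ p in Ioi (0 : ℝ), H p * Real.cos (2 * -(Real.pi * ξ) * p))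
      = 2 * ∫ p in Ioi (0 : ℝ), H p * Real.cos (2 * -(Real.pi * ξ) * p) by ring, ← this]
    congr 1
    ext v
    rw [smul_eq_mul, mul_comm]
    congr 2
    push_cast
    ring
  have hinv := Integrable.fourierInv_fourier_eq (f := fun p => (H p : ℂ)) (v := p) hH.ofReal
    (by rw [hF]; exact ((hAI.comp_mul_left' Real.pi_ne_zero).const_mul 4).ofReal)
    (by fun_prop)
  rw [hF, Real.fourierInv_eq'] at hinv
  have h2 := Measure.integral_comp_mul_left (fun τ : ℝ => ((4 * A τ : ℝ) : ℂ) *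
    Complex.exp (Complex.I * (2 * p : ℝ) * τ)) Real.pi
  have h3 := integral_even_mul_cexp (hAI.const_mul 4) (fun τ => by rw [hAe]) (2 * p)
  rw [h3] at h2
  have h4 : (H p : ℂ) = |Real.pi⁻¹| • ((2 * ∫ τ in Ioi (0 : ℝ), 4 * A τ * Real.cos (2 * p * τ)
      : ℝ) : ℂ) := by
    rw [← hinv, ← h2]
    congr 1
    ext ξ
    rw [smul_eq_mul, mul_comm]
    congr 2
    simp only [RCLike.inner_apply, conj_trivial]
    push_cast
    ring
  rw [abs_of_pos (inv_pos.2 Real.pi_pos), Complex.real_smul, ← Complex.ofReal_mul] at h4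
  rw [Complex.ofReal_injective h4]
  simp_rw [mul_assoc, integral_const_mul]
  ring

lemma hasDerivAt_integral_mul_cos {A : ℝ → ℝ} (hA : IntegrableOn A (Ioi 0))
    (hA' : IntegrableOn (fun τ => A τ * τ) (Ioi 0)) (p : ℝ) :
    HasDerivAt (fun p => ∫ τ in Ioi (0 : ℝ), A τ * Real.cos (2 * p * τ))
      (-2 * ∫ τ in Ioi (0 : ℝ), A τ * τ * Real.sin (2 * p * τ)) p := by
  have key := hasDerivAt_integral_of_dominated_loc_of_deriv_le (μ := volume.restrict (Ioi 0))
    (𝕜 := ℝ) (F := fun p τ : ℝ => A τ * Real.cos (2 * p * τ))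
    (F' := fun p τ : ℝ => -2 * (A τ * τ * Real.sin (2 * p * τ)))
    (x₀ := p) (bound := fun τ => 2 * ‖A τ * τ‖) univ_mem
    (Eventually.of_forall fun p => hA.aestronglyMeasurable.mul (by fun_prop))
    (hA.mul_bdd (c := 1) (by fun_prop) (Eventually.of_forall fun τ => Real.abs_cos_le_one _))
    ((hA'.aestronglyMeasurable.mul (by fun_prop)).const_mul _)
    (Eventually.of_forall fun τ q _ => by
      rw [norm_mul, norm_mul (A τ * τ), norm_neg, Real.norm_ofNat]
      gcongr
      exact mul_le_of_le_one_right (norm_nonneg _) (Real.abs_sin_le_one _))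
    (hA'.norm.const_mul 2)
    (Eventually.of_forall fun τ q _ => by
      have h1 : HasDerivAt (fun q : ℝ => 2 * q * τ) (2 * τ) q := by
        simpa using ((hasDerivAt_id q).const_mul 2).mul_const τ
      refine (h1.cos.const_mul (A τ)).congr_deriv ?_
      ring)
  refine key.2.congr_deriv ?_
  rw [integral_const_mul]

lemma hasDerivAt_integral_exp_neg_mul_cosh {φ : ℝ → ℝ} {M N : ℝ}
    (hφ : AEStronglyMeasurable φ (volume.restrict (Ioi 0))) (hM : ∀ y, 0 < y → |φ y| ≤ M)
    (hN : ∀ y, 0 < y → |y * φ y| ≤ N) (p : ℝ) :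
    HasDerivAt (fun p => ∫ y in Ioi (0 : ℝ), Real.exp (-y * Real.cosh p) * φ y)
      (-Real.sinh p * ∫ y in Ioi (0 : ℝ), Real.exp (-y * Real.cosh p) * (y * φ y)) p := by
  have hexp : IntegrableOn (fun y : ℝ => Real.exp (-y)) (Ioi 0) := by
    simpa using exp_neg_integrableOn_Ioi 0 one_pos
  have hle : ∀ q y : ℝ, 0 < y → Real.exp (-y * Real.cosh q) ≤ Real.exp (-y) := fun q y hy => by
    refine Real.exp_le_exp.2 ?_
    nlinarith [Real.one_le_cosh q]
  have key := hasDerivAt_integral_of_dominated_loc_of_deriv_le (μ := volume.restrict (Ioi 0))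
    (𝕜 := ℝ) (F := fun p y : ℝ => Real.exp (-y * Real.cosh p) * φ y)
    (F' := fun p y : ℝ => -Real.sinh p * (Real.exp (-y * Real.cosh p) * (y * φ y)))
    (x₀ := p) (bound := fun y => Real.cosh (|p| + 1) * (Real.exp (-y) * N))
    (Metric.ball_mem_nhds p one_pos)
    (Eventually.of_forall fun p => AEStronglyMeasurable.mul (by fun_prop) hφ)
    ((hexp.mul_const M).mono' (AEStronglyMeasurable.mul (by fun_prop) hφ) (by
      filter_upwards [ae_restrict_mem measurableSet_Ioi] with y hy
      rw [norm_mul, Real.norm_of_nonneg (Real.exp_pos _).le]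
      exact mul_le_mul (hle p y hy) (hM y hy) (norm_nonneg _) (Real.exp_pos _).le))
    ((AEStronglyMeasurable.mul (by fun_prop)
      (AEStronglyMeasurable.mul (by fun_prop) hφ)).const_mul _)
    (by
      filter_upwards [ae_restrict_mem measurableSet_Ioi] with y hy q hq
      rw [norm_mul, norm_mul (Real.exp _), Real.norm_of_nonneg (Real.exp_pos _).le, norm_neg,
        Real.norm_eq_abs]
      have h1 : |Real.sinh q| ≤ Real.cosh (|p| + 1) := by
        rw [Real.abs_sinh]
        refine (Real.sinh_lt_cosh _).le.trans (Real.cosh_le_cosh.2 ?_)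
        rw [abs_abs, abs_of_nonneg (by positivity : 0 ≤ |p| + 1)]
        rw [Metric.mem_ball, Real.dist_eq] at hq
        linarith [abs_sub_abs_le_abs_sub q p]
      exact mul_le_mul h1 (mul_le_mul (hle q y hy) (hN y hy) (norm_nonneg _) (Real.exp_pos _).le)
        (by positivity) (Real.cosh_pos _).le)
    ((hexp.mul_const N).const_mul _)
    (Eventually.of_forall fun y q _ => by
      refine (((Real.hasDerivAt_cosh q).const_mul (-y)).exp.mul_const (φ y)).congr_deriv ?_
      ring)
  refine key.2.congr_deriv ?_
  rw [integral_const_mul]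

lemma exp_neg_four_mul_rpow_div_le_one {x y : ℝ} (hx : 0 < x) (hy : 0 < y) :
    Real.exp (-(4 * x ^ (1 / 2 : ℝ) / y)) ≤ 1 :=
  Real.exp_le_one_iff.2 (neg_nonpos.2 (by positivity))

lemma exp_neg_four_mul_rpow_div_mul_inv_le {x y : ℝ} (hx : 0 < x) (hy : 0 < y) :
    Real.exp (-(4 * x ^ (1 / 2 : ℝ) / y)) * y⁻¹ ≤ x ^ (-(1 / 2) : ℝ) / 4 := by
  have h := exp_neg_le_inv (z := 4 * x ^ (1 / 2 : ℝ) / y) (by positivity)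
  calc _ ≤ (4 * x ^ (1 / 2 : ℝ) / y)⁻¹ * y⁻¹ := by gcongr
    _ = _ := by
      rw [Real.rpow_neg hx.le]
      field_simp

section

variable {f : ℝ → ℝ}

lemma continuousOn_integral_exp_neg_div_mul (hf : IntegrableOn f (Ioi 0)) :
    ContinuousOn (fun y : ℝ => ∫ x in Ioi (0 : ℝ), Real.exp (-(4 * x ^ (1 / 2 : ℝ) / y)) * f x)
      (Ioi 0) := by
  refine continuousOn_of_dominated (bound := fun x => ‖f x‖) (fun y _ => ?_) (fun y hy => ?_)
    hf.norm (Eventually.of_forall fun x y hy => ContinuousAt.continuousWithinAt ?_)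
  · exact (Measurable.aestronglyMeasurable (by fun_prop)).mul hf.aestronglyMeasurable
  · refine (ae_restrict_iff' measurableSet_Ioi).2 (Eventually.of_forall fun x hx => ?_)
    rw [norm_mul, Real.norm_of_nonneg (Real.exp_pos _).le]
    exact mul_le_of_le_one_left (norm_nonneg _) (exp_neg_four_mul_rpow_div_le_one hx hy)
  · have : y ≠ 0 := (mem_Ioi.1 hy).ne'
    fun_prop (disch := assumption)

lemma abs_integral_exp_neg_div_mul_le (hf : IntegrableOn f (Ioi 0)) {y : ℝ} (hy : 0 < y) :
    |∫ x in Ioi (0 : ℝ), Real.exp (-(4 * x ^ (1 / 2 : ℝ) / y)) * f x|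
      ≤ ∫ x in Ioi (0 : ℝ), ‖f x‖ := by
  rw [← Real.norm_eq_abs]
  refine norm_integral_le_of_norm_le hf.norm
    ((ae_restrict_iff' measurableSet_Ioi).2 (Eventually.of_forall fun x hx => ?_))
  rw [norm_mul, Real.norm_of_nonneg (Real.exp_pos _).le]
  exact mul_le_of_le_one_left (norm_nonneg _) (exp_neg_four_mul_rpow_div_le_one hx hy)

lemma abs_integral_exp_neg_div_mul_mul_inv_le
    (hf : IntegrableOn (fun x => f x * x ^ (-(1 / 2) : ℝ)) (Ioi 0)) {y : ℝ} (hy : 0 < y) :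
    |(∫ x in Ioi (0 : ℝ), Real.exp (-(4 * x ^ (1 / 2 : ℝ) / y)) * f x) * y⁻¹|
      ≤ ∫ x in Ioi (0 : ℝ), ‖f x * x ^ (-(1 / 2) : ℝ)‖ * (1 / 4) := by
  rw [← integral_mul_const, ← Real.norm_eq_abs]
  refine norm_integral_le_of_norm_le (hf.norm.mul_const _)
    ((ae_restrict_iff' measurableSet_Ioi).2 (Eventually.of_forall fun x hx => ?_))
  rw [mem_Ioi] at hx
  have h := exp_neg_four_mul_rpow_div_mul_inv_le hx hy
  rw [mul_right_comm, norm_mul, Real.norm_of_nonneg (by positivity), norm_mul,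
    Real.norm_of_nonneg (by positivity : (0 : ℝ) ≤ x ^ (-(1 / 2) : ℝ))]
  calc _ ≤ (x ^ (-(1 / 2) : ℝ) / 4) * ‖f x‖ := by gcongr
    _ = _ := by ring

lemma indexF_eq_integral_besselKi
    (hf : IntegrableOn (fun x => f x * x ^ (-(1 / 2) : ℝ)) (Ioi 0)) (τ : ℝ) :
    indexF f τ = 1 / 2 * ∫ y in Ioi (0 : ℝ), besselKi (2 * τ) y *
      ((∫ x in Ioi (0 : ℝ), Real.exp (-(4 * x ^ (1 / 2 : ℝ) / y)) * f x) * y⁻¹) := by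
  have hInt : Integrable (Function.uncurry fun x y : ℝ =>
      besselKi (2 * τ) y * (Real.exp (-(4 * x ^ (1 / 2 : ℝ) / y)) * y⁻¹) * f x)
      ((volume.restrict (Ioi 0)).prod (volume.restrict (Ioi 0))) := by
    have h1 : ∀ᵐ z ∂(((volume : Measure ℝ).restrict (Ioi 0)).prod
        ((volume : Measure ℝ).restrict (Ioi 0))), 0 < z.1 ∧ 0 < z.2 :=
      (Measure.quasiMeasurePreserving_fst.ae (ae_restrict_mem measurableSet_Ioi)).and
        (Measure.quasiMeasurePreserving_snd.ae (ae_restrict_mem measurableSet_Ioi))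
    have h2 := (hf.mul_prod (integrableOn_besselKi (2 * τ))).mul_bdd (c := 1 / 4)
      (g := fun z : ℝ × ℝ => z.1 ^ (1 / 2 : ℝ) *
        (Real.exp (-(4 * z.1 ^ (1 / 2 : ℝ) / z.2)) * z.2⁻¹))
      (Measurable.aestronglyMeasurable (by fun_prop)) (by
        filter_upwards [h1] with z hz
        obtain ⟨hx, hy⟩ := hz
        rw [Real.norm_of_nonneg (by positivity)]
        calc _ ≤ z.1 ^ (1 / 2 : ℝ) * (z.1 ^ (-(1 / 2) : ℝ) / 4) := by
              gcongr
              exact exp_neg_four_mul_rpow_div_mul_inv_le hx hy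
          _ = _ := by
            rw [Real.rpow_neg hx.le]
            field_simp)
    refine h2.congr ?_
    filter_upwards [h1] with z hz
    obtain ⟨hx, hy⟩ := hz
    simp only [Function.uncurry]
    rw [Real.rpow_neg hx.le]
    field_simp
  have hswap := integral_integral_swap hInt
  have e1 : indexF f τ = ∫ x in Ioi (0 : ℝ), 1 / 2 * ∫ y in Ioi (0 : ℝ),
      besselKi (2 * τ) y * (Real.exp (-(4 * x ^ (1 / 2 : ℝ) / y)) * y⁻¹) * f x := by
    refine setIntegral_congr_fun measurableSet_Ioi fun x hx => ?_
    rw [kernelK_eq hx, integral_mul_const, mul_assoc]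
  rw [e1, integral_const_mul, hswap]
  congr 2
  ext y
  rw [← integral_mul_const, ← integral_const_mul]
  congr 1
  ext x
  ring

/-- The derivative of the Fourier cosine inversion formula for the index transform. -/
lemma sinh_mul_laplace_eq_integral_indexF (hf : IntegrableOn f (Ioi 0))
    (hf' : IntegrableOn (fun x => f x * x ^ (-(1 / 2) : ℝ)) (Ioi 0))
    (hF : IntegrableOn (fun τ => indexF f τ * τ * Real.exp (Real.pi * τ)) (Ioi 0)) (p : ℝ) :
    Real.sinh p * ∫ y in Ioi (0 : ℝ), Real.exp (-y * Real.cosh p) *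
        ∫ x in Ioi (0 : ℝ), Real.exp (-(4 * x ^ (1 / 2 : ℝ) / y)) * f x
      = 16 / Real.pi * ∫ τ in Ioi (0 : ℝ), indexF f τ * τ * Real.sin (2 * p * τ) := by
  set Φ : ℝ → ℝ := fun y => ∫ x in Ioi (0 : ℝ), Real.exp (-(4 * x ^ (1 / 2 : ℝ) / y)) * f x
  have hΦc : ContinuousOn Φ (Ioi 0) := continuousOn_integral_exp_neg_div_mul hf
  have hφ : AEStronglyMeasurable (fun y => Φ y * y⁻¹) (volume.restrict (Ioi 0)) :=
    (hΦc.aestronglyMeasurable measurableSet_Ioi).mul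
      (Measurable.aestronglyMeasurable (by fun_prop))
  have hM := fun (y : ℝ) (hy : 0 < y) => abs_integral_exp_neg_div_mul_mul_inv_le hf' hy
  have hyφ : ∀ y : ℝ, 0 < y → y * (Φ y * y⁻¹) = Φ y := fun y hy => by field_simp
  have hd := hasDerivAt_integral_exp_neg_mul_cosh hφ hM
    (fun y hy => by rw [hyφ y hy]; exact abs_integral_exp_neg_div_mul_le hf hy)
  set H : ℝ → ℝ := fun p => ∫ y in Ioi (0 : ℝ), Real.exp (-y * Real.cosh p) * (Φ y * y⁻¹) with hH
  have hHi : Integrable H := (integrable_exp_neg_mul_cosh_mul hφ hM).integral_prod_right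
  have hHc : Continuous H := continuous_iff_continuousAt.2 fun p => (hd p).continuousAt
  have hA : ∀ τ, indexF f τ = 1 / 2 * ∫ p in Ioi (0 : ℝ), H p * Real.cos (2 * τ * p) := fun τ => by
    rw [indexF_eq_integral_besselKi hf', integral_besselKi_mul hφ hM]
  have hAc : Continuous (indexF f) := by
    have := ((continuous_integral_mul_cos hHi.integrableOn (S := Ioi 0)).comp
      (continuous_const_mul (2 : ℝ))).const_mul (1 / 2)
    refine this.congr fun τ => (hA τ).symm
  have hAτ : IntegrableOn (fun τ => indexF f τ * τ) (Ioi 0) := by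
    refine Integrable.mono hF (by fun_prop) ((ae_restrict_iff' measurableSet_Ioi).2
      (Eventually.of_forall fun τ hτ => ?_))
    rw [norm_mul _ (Real.exp _), Real.norm_of_nonneg (Real.exp_pos _).le]
    exact le_mul_of_one_le_right (norm_nonneg _)
      (Real.one_le_exp (mul_nonneg Real.pi_pos.le (le_of_lt hτ)))
  have hAi : IntegrableOn (indexF f) (Ioi 0) := by
    rw [← Ioc_union_Ioi_eq_Ioi zero_le_one]
    refine IntegrableOn.union (hAc.integrableOn_Ioc) ?_
    refine Integrable.mono (hAτ.mono_set (Ioi_subset_Ioi zero_le_one)) (by fun_prop)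
      ((ae_restrict_iff' measurableSet_Ioi).2 (Eventually.of_forall fun τ hτ => ?_))
    rw [norm_mul]
    exact le_mul_of_one_le_right (norm_nonneg _) ((le_of_lt hτ).trans (le_abs_self τ))
  have hinv := eq_integral_mul_cos_of_cosine_transform hHi hHc
    (fun p => by simp only [hH, Real.cosh_neg]) hA hAi
  have hd2 := (hasDerivAt_integral_mul_cos hAi hAτ p).const_mul (8 / Real.pi)
  rw [← funext hinv] at hd2
  have := (hd p).unique hd2
  have e : ∫ y in Ioi (0 : ℝ), Real.exp (-y * Real.cosh p) * (y * (Φ y * y⁻¹))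
      = ∫ y in Ioi (0 : ℝ), Real.exp (-y * Real.cosh p) * Φ y :=
    setIntegral_congr_fun measurableSet_Ioi fun y hy => by
      rw [hyφ y hy]
  rw [e] at this
  linear_combination -this

end

section

variable {D : ℝ → ℝ} {M : ℝ}

lemma integrableOn_exp_neg_mul_mul (hD : ContinuousOn D (Ioi 0)) (hM : ∀ y, 0 < y → |D y| ≤ M)
    {c : ℝ} (hc : 0 < c) : IntegrableOn (fun y => Real.exp (-y * c) * D y) (Ioi 0) := by
  have h : IntegrableOn (fun y : ℝ => Real.exp (-y * c)) (Ioi 0) := by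
    simpa [mul_comm c] using exp_neg_integrableOn_Ioi 0 hc
  exact h.mul_bdd (c := M) (hD.aestronglyMeasurable measurableSet_Ioi)
    ((ae_restrict_iff' measurableSet_Ioi).2 (Eventually.of_forall hM))

lemma integral_polynomial_exp_neg_mul_eq_zero (hD : ContinuousOn D (Ioi 0))
    (hM : ∀ y, 0 < y → |D y| ≤ M)
    (h0 : ∀ c, 1 < c → ∫ y in Ioi (0 : ℝ), Real.exp (-y * c) * D y = 0) (Q : Polynomial ℝ) :
    IntegrableOn (fun y => Q.eval (Real.exp (-y)) * (Real.exp (-y * 2) * D y)) (Ioi 0) ∧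
      ∫ y in Ioi (0 : ℝ), Q.eval (Real.exp (-y)) * (Real.exp (-y * 2) * D y) = 0 := by
  induction Q using Polynomial.induction_on' with
  | add p q hp hq =>
    simp only [Polynomial.eval_add, add_mul]
    exact ⟨hp.1.add hq.1, by rw [integral_add hp.1 hq.1, hp.2, hq.2, add_zero]⟩
  | monomial n a =>
    have e : ∀ y : ℝ, (Polynomial.monomial n a).eval (Real.exp (-y)) * (Real.exp (-y * 2) * D y)
        = a * (Real.exp (-y * (n + 2)) * D y) := fun y => by
      rw [Polynomial.eval_monomial, ← Real.exp_nat_mul, mul_add, Real.exp_add,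
        mul_comm (-y) (n : ℝ)]
      ring
    simp only [e]
    have hn : (1 : ℝ) < n + 2 := by
      linarith
    exact ⟨(integrableOn_exp_neg_mul_mul hD hM (by linarith)).const_mul a, by
      rw [integral_const_mul, h0 _ hn, mul_zero]⟩

lemma abs_mul_one_sub_mul_comp_neg_log_le (hM : ∀ y, 0 < y → |D y| ≤ M) {x : ℝ}
    (hx : x ∈ Icc (0 : ℝ) 1) : |x * (1 - x) * D (-Real.log x)| ≤ M * (x * (1 - x)) := by
  obtain ⟨h0, h1⟩ := hx
  rcases h0.eq_or_lt with rfl | h0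
  · simp
  rcases h1.eq_or_lt with rfl | h1
  · simp
  rw [abs_mul, abs_of_nonneg (mul_nonneg h0.le (sub_nonneg.2 h1.le)), mul_comm]
  have := hM _ (neg_pos.2 (Real.log_neg h0 h1))
  gcongr

lemma continuousOn_mul_one_sub_mul_comp_neg_log (hD : ContinuousOn D (Ioi 0))
    (hM : ∀ y, 0 < y → |D y| ≤ M) :
    ContinuousOn (fun x => x * (1 - x) * D (-Real.log x)) (Icc 0 1) := by
  have hend : ∀ x : ℝ, x * (1 - x) = 0 →
      ContinuousWithinAt (fun x => x * (1 - x) * D (-Real.log x)) (Icc 0 1) x := by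
    intro x hx
    rw [ContinuousWithinAt, hx, zero_mul]
    refine squeeze_zero_norm' (a := fun x => M * (x * (1 - x))) ?_ ?_
    · filter_upwards [self_mem_nhdsWithin] with z hz
      exact abs_mul_one_sub_mul_comp_neg_log_le hM hz
    · have : Continuous fun x : ℝ => M * (x * (1 - x)) := by fun_prop
      have h := this.continuousWithinAt (s := Icc 0 1) (x := x)
      rwa [ContinuousWithinAt, hx, mul_zero] at h
  rintro x ⟨h0, h1⟩
  rcases h0.eq_or_lt with rfl | h0
  · exact hend 0 (by simp)
  rcases h1.eq_or_lt with rfl | h1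
  · exact hend 1 (by simp)
  have hDx : ContinuousAt D (-Real.log x) :=
    hD.continuousAt (Ioi_mem_nhds (neg_pos.2 (Real.log_neg h0 h1)))
  refine ContinuousAt.continuousWithinAt (ContinuousAt.mul (by fun_prop) ?_)
  exact ContinuousAt.comp (f := fun x => -Real.log x) (g := D) hDx
    (Real.continuousAt_log h0.ne').neg

/-- A bounded continuous function on the half line is determined by its Laplace transform. -/
lemma eq_zero_of_laplace_eq_zero (hD : ContinuousOn D (Ioi 0)) (hM : ∀ y, 0 < y → |D y| ≤ M)
    (h0 : ∀ c, 1 < c → ∫ y in Ioi (0 : ℝ), Real.exp (-y * c) * D y = 0) {y : ℝ} (hy : 0 < y) :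
    D y = 0 := by
  set G : ℝ → ℝ := fun y => Real.exp (-y) * (1 - Real.exp (-y)) * D y with hG
  have hGc : ContinuousOn G (Ioi 0) := ContinuousOn.mul (by fun_prop) hD
  have hM0 : 0 ≤ M := (abs_nonneg _).trans (hM 1 one_pos)
  have hmem : ∀ y : ℝ, 0 < y → Real.exp (-y) ∈ Icc (0 : ℝ) 1 := fun y hy =>
    ⟨(Real.exp_pos _).le, Real.exp_le_one_iff.2 (by linarith)⟩
  have hGh : ∀ y, Real.exp (-y) * (1 - Real.exp (-y)) * D (-Real.log (Real.exp (-y))) = G y :=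
    fun y => by rw [Real.log_exp, neg_neg]
  have hGM : ∀ y, 0 < y → |G y| ≤ M := fun y hy => by
    rw [← hGh]
    refine (abs_mul_one_sub_mul_comp_neg_log_le hM (hmem y hy)).trans ?_
    have := hmem y hy
    exact mul_le_of_le_one_right hM0 (by nlinarith [this.1, this.2])
  have hexp : IntegrableOn (fun y : ℝ => Real.exp (-y)) (Ioi 0) := by
    simpa using exp_neg_integrableOn_Ioi 0 one_pos
  have hGm := hGc.aestronglyMeasurable (μ := volume) measurableSet_Ioi
  have hGi : IntegrableOn (fun y => Real.exp (-y) * (G y * G y)) (Ioi 0) := by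
    refine hexp.mul_bdd (c := M * M) (hGm.mul hGm)
      ((ae_restrict_iff' measurableSet_Ioi).2 (Eventually.of_forall fun y hy => ?_))
    rw [norm_mul]
    exact mul_self_le_mul_self (norm_nonneg _) (hGM y hy)
  have hle : ∀ ε : ℝ, 0 < ε → ∫ y in Ioi (0 : ℝ), Real.exp (-y) * (G y * G y) ≤ M * ε := by
    intro ε hε
    obtain ⟨P, hP⟩ := exists_polynomial_near_of_continuousOn 0 1 _
      (continuousOn_mul_one_sub_mul_comp_neg_log hD hM) ε hε
    have hz := integral_polynomial_exp_neg_mul_eq_zero hD hM h0 ((1 - Polynomial.X) * P)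
    have e : ∀ y : ℝ, ((1 - Polynomial.X) * P).eval (Real.exp (-y)) * (Real.exp (-y * 2) * D y)
        = Real.exp (-y) * (G y * P.eval (Real.exp (-y))) := fun y => by
      rw [mul_two, Real.exp_add]
      simp [hG]
      ring
    simp only [e] at hz
    have hsub := integral_sub hGi hz.1
    rw [hz.2, sub_zero] at hsub
    rw [← hsub]
    calc _ ≤ ∫ y in Ioi (0 : ℝ), Real.exp (-y) * (M * ε) := by
          refine setIntegral_mono_on (hGi.sub hz.1) (hexp.mul_const _) measurableSet_Ioi
            fun y hy => ?_
          rw [← mul_sub, ← mul_sub]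
          refine mul_le_mul_of_nonneg_left ?_ (Real.exp_pos _).le
          refine (le_abs_self _).trans ?_
          rw [abs_mul, abs_sub_comm]
          have := hP _ (hmem y hy)
          rw [hGh] at this
          exact mul_le_mul (hGM y hy) this.le (abs_nonneg _) hM0
      _ = M * ε := by rw [integral_mul_const, integral_exp_neg_Ioi_zero, one_mul]
  have hnn : ∀ y, 0 ≤ Real.exp (-y) * (G y * G y) := fun y =>
    mul_nonneg (Real.exp_pos _).le (mul_self_nonneg _)
  have hzero : ∫ y in Ioi (0 : ℝ), Real.exp (-y) * (G y * G y) = 0 := by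
    refine le_antisymm (le_of_forall_pos_le_add fun ε hε => ?_) (integral_nonneg hnn)
    rw [zero_add]
    refine (hle (ε / (M + 1)) (by positivity)).trans ?_
    rw [mul_div_assoc', div_le_iff₀ (by positivity)]
    nlinarith
  have hae := (integral_eq_zero_iff_of_nonneg hnn hGi).1 hzero
  have heq := Measure.eqOn_open_of_ae_eq hae isOpen_Ioi
    (ContinuousOn.mul (by fun_prop) (hGc.mul hGc)) continuousOn_const hy
  have hlt : Real.exp (-y) < 1 := by simpa using hy
  simpa [hG, sub_eq_zero, hlt.ne'] using heq

end

lemma continuous_uncurry_exp_neg_mul_cosh_mul_cos : Continuous (Function.uncurry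
    fun (z : ℝ × ℝ) (p : ℝ) => Real.exp (-z.2 * Real.cosh p) * Real.cos (z.1 * p)) := by
  unfold Function.uncurry
  fun_prop

lemma measurable_besselKi : Measurable fun z : ℝ × ℝ => besselKi z.1 z.2 :=
  (StronglyMeasurable.integral_prod_right
    continuous_uncurry_exp_neg_mul_cosh_mul_cos.stronglyMeasurable).measurable

lemma continuousOn_besselKi (σ : ℝ) : ContinuousOn (besselKi σ) (Ioi 0) := by
  refine continuousOn_of_forall_continuousAt fun y hy => ?_
  rw [mem_Ioi] at hy
  refine continuousAt_of_dominated (bound := fun t => Real.exp (-(y / 2) * Real.cosh t))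
    (Eventually.of_forall fun y => by fun_prop) ?_
    (integrable_exp_neg_mul_cosh (half_pos hy)).integrableOn
    (Eventually.of_forall fun t => by fun_prop)
  filter_upwards [Ioi_mem_nhds (half_lt_self hy)] with z hz
  refine Eventually.of_forall fun t => ?_
  rw [norm_mul, Real.norm_of_nonneg (Real.exp_pos _).le]
  refine (mul_le_of_le_one_right (Real.exp_pos _).le (Real.abs_cos_le_one _)).trans ?_
  have := mem_Ioi.1 hz
  gcongr

lemma abs_scaled_inverse_kernel_le {y τ : ℝ} (hy : 0 < y) (hτ : 0 < τ) :
    |Real.sinh (2 * Real.pi * τ) * Real.exp (-(Real.pi * τ)) * besselKi (2 * τ) y|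
      ≤ 2 * Real.pi := by
  have h := abs_inverse_kernel_le hy hτ
  rw [mul_assoc, abs_mul, abs_of_pos hτ, mul_left_comm (2 * Real.pi)] at h
  have h2 := le_of_mul_le_mul_left h hτ
  rw [mul_right_comm, abs_mul, abs_of_pos (Real.exp_pos _), Real.exp_neg]
  rwa [← div_eq_mul_inv, div_le_iff₀ (Real.exp_pos _)]

lemma abs_integral_mul_scaled_inverse_kernel_le {g : ℝ → ℝ} (hg : IntegrableOn g (Ioi 0))
    {y : ℝ} (hy : 0 < y) :
    |∫ τ in Ioi (0 : ℝ), g τ * (Real.sinh (2 * Real.pi * τ) * Real.exp (-(Real.pi * τ))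
      * besselKi (2 * τ) y)| ≤ ∫ τ in Ioi (0 : ℝ), ‖g τ‖ * (2 * Real.pi) := by
  rw [← Real.norm_eq_abs]
  refine norm_integral_le_of_norm_le (hg.norm.mul_const _)
    ((ae_restrict_iff' measurableSet_Ioi).2 (Eventually.of_forall fun τ hτ => ?_))
  rw [norm_mul]
  exact mul_le_mul_of_nonneg_left (abs_scaled_inverse_kernel_le hy hτ) (norm_nonneg _)

lemma continuousOn_integral_mul_scaled_inverse_kernel {g : ℝ → ℝ} (hg : IntegrableOn g (Ioi 0)) :
    ContinuousOn (fun y => ∫ τ in Ioi (0 : ℝ), g τ * (Real.sinh (2 * Real.pi * τ)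
      * Real.exp (-(Real.pi * τ)) * besselKi (2 * τ) y)) (Ioi 0) := by
  refine continuousOn_of_dominated (bound := fun τ => ‖g τ‖ * (2 * Real.pi))
    (fun y _ => ?_) (fun y hy => ?_)
    (hg.norm.mul_const _) (Eventually.of_forall fun τ => ?_)
  · refine hg.aestronglyMeasurable.mul (Measurable.aestronglyMeasurable ?_)
    have := measurable_besselKi.comp (f := fun τ : ℝ => (2 * τ, y)) (by fun_prop)
    exact Measurable.mul (by fun_prop) this
  · refine (ae_restrict_iff' measurableSet_Ioi).2 (Eventually.of_forall fun τ hτ => ?_)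
    rw [norm_mul]
    exact mul_le_mul_of_nonneg_left (abs_scaled_inverse_kernel_le hy hτ) (norm_nonneg _)
  · exact continuousOn_const.mul (continuousOn_const.mul (continuousOn_besselKi _))

lemma sinh_mul_laplace_integral_mul_scaled_inverse_kernel {g : ℝ → ℝ} (hg : IntegrableOn g (Ioi 0))
    {p : ℝ} (hp : 0 < p) :
    Real.sinh p * ∫ y in Ioi (0 : ℝ), Real.exp (-y * Real.cosh p) *
        ∫ τ in Ioi (0 : ℝ), g τ * (Real.sinh (2 * Real.pi * τ) * Real.exp (-(Real.pi * τ))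
          * besselKi (2 * τ) y)
      = Real.pi * ∫ τ in Ioi (0 : ℝ), g τ * Real.exp (-(Real.pi * τ)) * Real.sin (2 * p * τ) := by
  have hexp : IntegrableOn (fun y : ℝ => Real.exp (-y * Real.cosh p)) (Ioi 0) := by
    simpa [mul_comm (Real.cosh p)] using exp_neg_integrableOn_Ioi 0 (Real.cosh_pos p)
  have h1 : ∀ᵐ z ∂(((volume : Measure ℝ).restrict (Ioi 0)).prod
      ((volume : Measure ℝ).restrict (Ioi 0))), 0 < z.1 ∧ 0 < z.2 :=
    (Measure.quasiMeasurePreserving_fst.ae (ae_restrict_mem measurableSet_Ioi)).and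
      (Measure.quasiMeasurePreserving_snd.ae (ae_restrict_mem measurableSet_Ioi))
  have hInt : Integrable (Function.uncurry fun y τ : ℝ => Real.exp (-y * Real.cosh p) * g τ *
      (Real.sinh (2 * Real.pi * τ) * Real.exp (-(Real.pi * τ)) * besselKi (2 * τ) y))
      ((volume.restrict (Ioi 0)).prod (volume.restrict (Ioi 0))) := by
    refine (hexp.mul_prod hg).mul_bdd (c := 2 * Real.pi) (g := fun z : ℝ × ℝ =>
      Real.sinh (2 * Real.pi * z.2) * Real.exp (-(Real.pi * z.2)) * besselKi (2 * z.2) z.1)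
      (Measurable.aestronglyMeasurable ?_) ?_
    · have := measurable_besselKi.comp (f := fun z : ℝ × ℝ => (2 * z.2, z.1)) (by fun_prop)
      exact Measurable.mul (by fun_prop) this
    · filter_upwards [h1] with z hz using abs_scaled_inverse_kernel_le hz.1 hz.2
  have hswap := integral_integral_swap hInt
  simp_rw [← integral_const_mul, ← mul_assoc] at hswap ⊢
  simp_rw [mul_assoc (Real.sinh p), integral_const_mul (Real.sinh p)]
  rw [hswap, ← integral_const_mul]
  refine setIntegral_congr_fun measurableSet_Ioi fun τ hτ => ?_
  rw [mem_Ioi] at hτ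
  have h := sinh_mul_laplace_besselKi (σ := 2 * τ) (by positivity) hp
  have hs : Real.sinh (Real.pi * (2 * τ)) ≠ 0 := by
    rw [Ne, Real.sinh_eq_zero]
    positivity
  have e : ∫ y in Ioi (0 : ℝ), Real.exp (-y * Real.cosh p) * g τ * Real.sinh (2 * Real.pi * τ) *
      Real.exp (-(Real.pi * τ)) * besselKi (2 * τ) y
      = (g τ * Real.sinh (Real.pi * (2 * τ)) * Real.exp (-(Real.pi * τ))) *
        ∫ y in Ioi (0 : ℝ), Real.exp (-Real.cosh p * y) * besselKi (2 * τ) y := by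
    rw [← integral_const_mul]
    congr 1
    ext y
    rw [show Real.pi * (2 * τ) = 2 * Real.pi * τ by ring,
      show -Real.cosh p * y = -y * Real.cosh p by ring]
    ring
  rw [e, mul_left_comm, h, show 2 * p * τ = 2 * τ * p by ring]
  field_simp

/-- Inversion of the index transform after a Laplace-type transform of the density. -/
lemma integral_exp_neg_div_mul_eq_integral_indexF {f : ℝ → ℝ} (hf : IntegrableOn f (Ioi 0))
    (hf' : IntegrableOn (fun x => f x * x ^ (-(1 / 2) : ℝ)) (Ioi 0))
    (hF : IntegrableOn (fun τ => indexF f τ * τ * Real.exp (Real.pi * τ)) (Ioi 0)) {y : ℝ}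
    (hy : 0 < y) :
    ∫ x in Ioi (0 : ℝ), Real.exp (-(4 * x ^ (1 / 2 : ℝ) / y)) * f x
      = 16 / Real.pi ^ 2 * ∫ τ in Ioi (0 : ℝ),
        τ * Real.sinh (2 * Real.pi * τ) * besselKi (2 * τ) y * indexF f τ := by
  set Φ : ℝ → ℝ := fun y => ∫ x in Ioi (0 : ℝ), Real.exp (-(4 * x ^ (1 / 2 : ℝ) / y)) * f x
  set R : ℝ → ℝ := fun y => ∫ τ in Ioi (0 : ℝ), indexF f τ * τ * Real.exp (Real.pi * τ) *
    (Real.sinh (2 * Real.pi * τ) * Real.exp (-(Real.pi * τ)) * besselKi (2 * τ) y) with hR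
  have hΦc : ContinuousOn Φ (Ioi 0) := continuousOn_integral_exp_neg_div_mul hf
  have hRc : ContinuousOn R (Ioi 0) := continuousOn_integral_mul_scaled_inverse_kernel hF
  have hΦb := fun (y : ℝ) (hy : 0 < y) => abs_integral_exp_neg_div_mul_le hf hy
  have hRb := fun (y : ℝ) (hy : 0 < y) => abs_integral_mul_scaled_inverse_kernel_le hF hy
  have hcancel : ∀ τ, Real.exp (Real.pi * τ) * Real.exp (-(Real.pi * τ)) = 1 := fun τ => by
    rw [← Real.exp_add, add_neg_cancel, Real.exp_zero]
  have hlap : ∀ c, 1 < c → ∫ y in Ioi (0 : ℝ),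
      Real.exp (-y * c) * (Φ y - 16 / Real.pi ^ 2 * R y) = 0 := by
    intro c hc
    obtain ⟨p, hp, rfl⟩ : ∃ p, 0 < p ∧ Real.cosh p = c :=
      ⟨Real.arcosh c, Real.arcosh_pos hc, Real.cosh_arcosh hc.le⟩
    have h1 := sinh_mul_laplace_eq_integral_indexF hf hf' hF p
    have h2 := sinh_mul_laplace_integral_mul_scaled_inverse_kernel hF hp
    have e : ∀ τ, indexF f τ * τ * Real.exp (Real.pi * τ) * Real.exp (-(Real.pi * τ)) *
        Real.sin (2 * p * τ) = indexF f τ * τ * Real.sin (2 * p * τ) := fun τ => by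
      rw [mul_assoc (indexF f τ * τ), hcancel, mul_one]
    simp_rw [e] at h2
    have hi1 := integrableOn_exp_neg_mul_mul hΦc hΦb (Real.cosh_pos p)
    have hi2 := integrableOn_exp_neg_mul_mul hRc hRb (Real.cosh_pos p)
    have hs := integral_sub hi1 (hi2.const_mul (16 / Real.pi ^ 2))
    rw [integral_const_mul] at hs
    have e2 : ∀ y, Real.exp (-y * Real.cosh p) * (Φ y - 16 / Real.pi ^ 2 * R y)
        = Real.exp (-y * Real.cosh p) * Φ y
          - 16 / Real.pi ^ 2 * (Real.exp (-y * Real.cosh p) * R y) := fun y => by ring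
    simp_rw [e2]
    rw [hs]
    have hsp : Real.sinh p ≠ 0 := (Real.sinh_pos_iff.2 hp).ne'
    refine (mul_eq_zero.1 ?_).resolve_left hsp
    rw [mul_sub, mul_left_comm, h1, h2]
    generalize (∫ τ in Ioi (0 : ℝ), indexF f τ * τ * Real.sin (2 * p * τ)) = S
    field_simp
    ring
  have hDb : ∀ y, 0 < y → |Φ y - 16 / Real.pi ^ 2 * R y| ≤ (∫ x in Ioi (0 : ℝ), ‖f x‖)
      + 16 / Real.pi ^ 2 * ∫ τ in Ioi (0 : ℝ), ‖indexF f τ * τ * Real.exp (Real.pi * τ)‖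
        * (2 * Real.pi) := fun y hy => by
    refine (abs_sub _ _).trans (add_le_add (hΦb y hy) ?_)
    rw [abs_mul, abs_of_nonneg (by positivity : 0 ≤ 16 / Real.pi ^ 2)]
    exact mul_le_mul_of_nonneg_left (hRb y hy) (by positivity)
  have h : Φ y - 16 / Real.pi ^ 2 * R y = 0 :=
    eq_zero_of_laplace_eq_zero (hΦc.sub (continuousOn_const.mul hRc)) hDb hlap hy
  refine (sub_eq_zero.1 h).trans ?_
  simp only [hR]
  congr 2
  ext τ
  linear_combination (indexF f τ * τ * Real.sinh (2 * Real.pi * τ) * besselKi (2 * τ) y) * hcancel τ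

/-- Equality (2.15). -/
theorem mellin_line_integral_eq (ν a b : ℝ) (hν1 : 0 < ν) (hν2 : ν < 1/2)
    (f : ℝ → ℝ) (hf : MeasureTheory.LocallyIntegrableOn f (Set.Ioi 0))
    (ha : a < ν) (hb1 : 5/4 < b) (hb2 : b < 3/2)
    (hO0 : f =O[nhdsWithin 0 (Set.Ioi 0)] fun x => x ^ (-a))
    (hOinf : f =O[atTop] fun x => x ^ (-b))
    (hm1 : mellinT f 1 = 0) (hm2 : deriv (mellinT f) 1 = 0)
    (hFint : MeasureTheory.IntegrableOn (fun τ => indexF f τ * τ * Real.exp (Real.pi*τ)) (Set.Ioi 0)) :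
    ∀ t : ℝ, 0 < t →
      (1/(2*(Real.pi:ℂ))) * (∫ u : ℝ,
          Complex.Gamma (((1-ν:ℝ):ℂ) + (u:ℂ)*Complex.I)
          * Complex.Gamma (1/2 + (((1-ν:ℝ):ℂ) + (u:ℂ)*Complex.I))
          * mellinT f (1 - (((1-ν:ℝ):ℂ) + (u:ℂ)*Complex.I))
          * (t:ℂ) ^ (-(((1-ν:ℝ):ℂ) + (u:ℂ)*Complex.I)))
      = (((16/Real.pi^((3:ℝ)/2)) * ∫ τ in Set.Ioi (0:ℝ),
            τ * Real.sinh (2*Real.pi*τ) * besselKi (2*τ) (2/Real.sqrt t) * indexF f τ : ℝ) : ℂ) := by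
  intro t ht
  have hmom : ∀ s : ℝ, ν ≤ s → s ≤ 1 → IntegrableOn (fun x => f x * x ^ (s - 1)) (Ioi 0) := by
    intro s h1 h2
    refine (mellin_convergent_of_isBigO_scalar hf hOinf (by linarith) hO0 (by linarith)).congr_fun
      (fun x _ => mul_comm _ _) measurableSet_Ioi
  have hf1 : IntegrableOn f (Ioi 0) := by
    simpa using hmom 1 (by linarith) le_rfl
  have hf2 : IntegrableOn (fun x => f x * x ^ (-(1 / 2) : ℝ)) (Ioi 0) := by
    have := hmom (1 / 2) hν2.le (by norm_num)
    norm_num at this ⊢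
    exact this
  have e : ∀ x : ℝ, 0 < x →
      2 * (t * x) ^ (1 / 2 : ℝ) = 4 * x ^ (1 / 2 : ℝ) / (2 / Real.sqrt t) := fun x hx => by
    rw [Real.mul_rpow ht.le hx.le, ← Real.sqrt_eq_rpow t]
    field_simp
    ring
  have e2 : ∫ x in Ioi (0 : ℝ), Real.exp (-(2 * (t * x) ^ (1 / 2 : ℝ))) * f x
      = ∫ x in Ioi (0 : ℝ), Real.exp (-(4 * x ^ (1 / 2 : ℝ) / (2 / Real.sqrt t))) * f x :=
    setIntegral_congr_fun measurableSet_Ioi fun x hx => by simp only [e x hx]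
  have hpi : Real.sqrt Real.pi * (16 / Real.pi ^ 2) = 16 / Real.pi ^ ((3 : ℝ) / 2) := by
    have h2 : Real.pi ^ 2 = Real.pi ^ ((3 : ℝ) / 2) * Real.sqrt Real.pi := by
      rw [Real.sqrt_eq_rpow, ← Real.rpow_add Real.pi_pos, ← Real.rpow_natCast]
      norm_num
    rw [h2]
    field_simp
  rw [mellin_barnes_eq (by linarith) ht (hmom ν le_rfl (by linarith)), e2,
    integral_exp_neg_div_mul_eq_integral_indexF hf1 hf2 hFint (by positivity), ← mul_assoc, hpi]
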